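/- arXiv:2207.06727 — 2 statements merged into one kernel-verified Lean document; each statement's English description precedes it below -/
import Mathlib

section
/- Let V be an n-dimensional vector space over F_q with n > 1, and let F ⊆ L(V) be an antichain with F ⊄ [V choose ⌊n/2⌋] and F ⊄ [V choose ⌈n/2⌉]. Then |F| ≤ [n choose ⌊n/2⌋]_q − q·[⌊n/2⌋ choose 1]_q. Equality holds if and only if F = ([V choose ⌈n/2⌉] \ {F : U ≤ F}) ∪ {U} for some fixed (⌈n/2⌉−1)-dimensional subspace U, or F = ([V choose ⌊n/2⌋] \ {F : F ≤ W}) ∪ {W} for some fixed (⌊n/2⌋+1)-dimensional subspace W. -/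
open Module Set

/-- The Gaussian (q-)binomial coefficient, via the standard Pascal-type recurrence. -/
def gbinom (q : ℕ) : ℕ → ℕ → ℕ
  | _, 0 => 1
  | 0, _ + 1 => 0
  | n + 1, k + 1 => gbinom q n k + q ^ (k + 1) * gbinom q n (k + 1)

/-- product counting independent tuples -/
def PP (q n k : ℕ) : ℤ := ∏ i ∈ Finset.range k, ((q : ℤ) ^ n - (q : ℤ) ^ i)

theorem PP_succ (q n k : ℕ) : PP q n (k+1) = PP q n k * ((q:ℤ)^n - (q:ℤ)^k) := by
  simp [PP, Finset.prod_range_succ]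

theorem PP_succ' (q n k : ℕ) : PP q (n+1) (k+1) = ((q:ℤ)^(n+1) - 1) * (q:ℤ)^k * PP q n k := by
  unfold PP
  rw [Finset.prod_range_succ']
  have : ∀ i ∈ Finset.range k, ((q:ℤ)^(n+1) - (q:ℤ)^(i+1)) = q * ((q:ℤ)^n - (q:ℤ)^i) := by
    intro i _; ring
  rw [Finset.prod_congr rfl this, Finset.prod_mul_distrib]
  simp
  ring

theorem gb_zero (q n : ℕ) : gbinom q n 0 = 1 := by cases n <;> rfl

theorem gb_formula (q n k : ℕ) : (gbinom q n k : ℤ) * PP q k k = PP q n k := by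
  induction n generalizing k with
  | zero =>
    cases k with
    | zero => simp [gbinom, PP]
    | succ k => simp [gbinom, PP, Finset.prod_range_succ']
  | succ n ih =>
    cases k with
    | zero => simp [gbinom, PP]
    | succ k =>
      have h1 := ih k
      have h2 := ih (k+1)
      rw [PP_succ' q k k, PP_succ q n k] at h2
      rw [PP_succ' q k k, PP_succ' q n k, gbinom]
      push_cast
      linear_combination ((q:ℤ)^(k+1) - 1) * (q:ℤ)^k * h1 + (q:ℤ)^(k+1) * h2

theorem gb_one_succ (q n : ℕ) : gbinom q (n+1) 1 = 1 + q * gbinom q n 1 := by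
  rw [gbinom]; simp [gb_zero]

theorem gb_one (q n : ℕ) : ((q:ℤ) - 1) * gbinom q n 1 = (q:ℤ)^n - 1 := by
  induction n with
  | zero => simp [gbinom]
  | succ n ih =>
    rw [gb_one_succ]; push_cast; linear_combination (q:ℤ) * ih

theorem PP_pos {q : ℕ} (hq : 2 ≤ q) {n k : ℕ} (h : k ≤ n) : 0 < PP q n k := by
  apply Finset.prod_pos
  intro i hi
  have : i < n := lt_of_lt_of_le (Finset.mem_range.1 hi) h
  have := pow_lt_pow_right₀ (a := (q:ℤ)) (by exact_mod_cast hq) this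
  linarith

theorem gb_ratio {q : ℕ} (hq : 2 ≤ q) {n k : ℕ} (h : k ≤ n) :
    gbinom q n (k+1) * gbinom q (k+1) 1 = gbinom q n k * gbinom q (n-k) 1 := by
  have h0 := PP_pos hq (le_refl k)
  have h1 := gb_formula q n (k+1)
  have h2 := gb_formula q n k
  have h3 := gb_one q (k+1)
  have h4 := gb_one q (n-k)
  have h5 : (q:ℤ)^n = (q:ℤ)^k * (q:ℤ)^(n-k) := by rw [← pow_add]; congr 1; omega
  have hq1 : ((q:ℤ) - 1) ≠ 0 := by have : (2:ℤ) ≤ q := by exact_mod_cast hq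
                                   linarith
  have hqk : (q:ℤ)^k ≠ 0 := by positivity
  rw [PP_succ', PP_succ, ← h2, h5] at h1
  zify
  apply mul_left_cancel₀ hq1
  apply mul_left_cancel₀ hqk
  apply mul_left_cancel₀ h0.ne'
  linear_combination h1 + (q:ℤ)^k * PP q k k * gbinom q n (k+1) * h3 - (q:ℤ)^k * PP q k k * gbinom q n k * h4

theorem gb_one_mono {q : ℕ} (hq : 2 ≤ q) {a b : ℕ} (h : a ≤ b) : gbinom q a 1 ≤ gbinom q b 1 := by
  induction b, h using Nat.le_induction with
  | base => rfl
  | succ b _ ih => rw [gb_one_succ]; nlinarith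

theorem gb_one_pos {q : ℕ} {a : ℕ} (h : 0 < a) : 0 < gbinom q a 1 := by
  obtain ⟨b, rfl⟩ : ∃ b, a = b+1 := ⟨a-1, by omega⟩
  rw [gb_one_succ]; omega

theorem gb_pos {q : ℕ} (hq : 2 ≤ q) {n k : ℕ} (h : k ≤ n) : 0 < gbinom q n k := by
  have h1 := gb_formula q n k
  have h2 := PP_pos hq h
  rw [← h1] at h2
  have := pos_of_mul_pos_left h2 (PP_pos hq (le_refl k)).le
  exact_mod_cast this

open Classical in
/-- independent tuples -/
noncomputable def Om (K V ι : Type*) [Field K] [AddCommGroup V] [Module K V] [Fintype V] [Fintype ι] :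
    Finset (ι → V) := Finset.univ.filter (fun v => LinearIndependent K v)

open Classical in
/-- subspaces of dimension k -/
noncomputable def lev (K V : Type*) [Field K] [AddCommGroup V] [Module K V]
    [Fintype (Submodule K V)] (k : ℕ) : Finset (Submodule K V) :=
  Finset.univ.filter (fun S => finrank K S = k)

open Classical in
/-- upper shadow -/
noncomputable def up {K V : Type*} [Field K] [AddCommGroup V] [Module K V]
    [Fintype (Submodule K V)] (k : ℕ) (A : Finset (Submodule K V)) : Finset (Submodule K V) :=
  Finset.univ.filter (fun Y => finrank K Y = k + 1 ∧ ∃ S ∈ A, S ≤ Y)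

set_option linter.unusedSectionVars false
section
variable {K V : Type*} [Field K] [Fintype K] [AddCommGroup V] [Module K V] [FiniteDimensional K V]
  [Fintype V] [Fintype (Submodule K V)]

theorem mem_lev {k : ℕ} {S : Submodule K V} : S ∈ lev K V k ↔ finrank K S = k := by simp [lev]

theorem mem_up {k : ℕ} {A : Finset (Submodule K V)} {S : Submodule K V} :
    S ∈ up k A ↔ finrank K S = k+1 ∧ ∃ T ∈ A, T ≤ S := by simp [up]

theorem mem_Om {ι : Type*} [Fintype ι] {v : ι → V} : v ∈ Om K V ι ↔ LinearIndependent K v := by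
  simp [Om]

theorem card_Om {k : ℕ} (hk : k ≤ finrank K V) :
    ((Om K V (Fin k)).card : ℤ) = PP (Fintype.card K) (finrank K V) k := by
  classical
  have h := card_linearIndependent (K := K) (V := V) hk
  rw [Nat.card_eq_fintype_card, Fintype.card_subtype] at h
  have : (Om K V (Fin k)).card = ∏ i : Fin k, (Fintype.card K ^ finrank K V - Fintype.card K ^ i.val) := by
    rw [← h]; unfold Om; congr; exact Subsingleton.elim _ _
  rw [this, PP, Finset.prod_range]
  push_cast
  apply Finset.prod_congr rfl
  intro i _
  rw [Nat.cast_sub]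
  · push_cast; rfl
  · exact Nat.pow_le_pow_right Fintype.card_pos (by omega)

open Classical in
/-- bases of S -/
theorem card_bas {k : ℕ} {S : Submodule K V} (hS : finrank K S = k) :
    (((Om K V (Fin k)).filter (fun v => Submodule.span K (Set.range v) = S)).card : ℤ)
      = PP (Fintype.card K) k k := by
  have : Fintype S := Fintype.ofFinite _
  have h := card_Om (K := K) (V := S) (k := k) hS.ge
  rw [hS] at h
  rw [← h]
  congr 1
  symm
  apply Finset.card_bij (fun (v : Fin k → S) _ => fun i => (v i : V))
  · intro v hv
    rw [mem_Om] at hv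
    have hli : LinearIndependent K (fun i => (v i : V)) :=
      hv.map' S.subtype (Submodule.ker_subtype S)
    simp only [Finset.mem_filter, mem_Om]
    refine ⟨hli, ?_⟩
    apply Submodule.eq_of_le_of_finrank_eq
    · rw [Submodule.span_le]; rintro _ ⟨i, rfl⟩; exact (v i).2
    · rw [finrank_span_eq_card hli]; simp [hS]
  · intro v _ w _ hvw
    funext i; exact Subtype.ext (congrFun hvw i)
  · intro w hw
    simp only [Finset.mem_filter, mem_Om] at hw
    have hm : ∀ i, w i ∈ S := fun i => by rw [← hw.2]; exact Submodule.subset_span ⟨i, rfl⟩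
    refine ⟨fun i => ⟨w i, hm i⟩, ?_, rfl⟩
    rw [mem_Om]
    exact LinearIndependent.of_comp S.subtype hw.1

theorem card_lev {k : ℕ} (hk : k ≤ finrank K V) :
    (lev K V k).card = gbinom (Fintype.card K) (finrank K V) k := by
  classical
  have hq : 2 ≤ Fintype.card K := Fintype.one_lt_card
  have h1 := card_Om (K := K) (V := V) hk
  have h2 : (Om K V (Fin k)).card = ∑ S ∈ lev K V k,
      ((Om K V (Fin k)).filter (fun v => Submodule.span K (Set.range v) = S)).card := by
    apply Finset.card_eq_sum_card_fiberwise
    intro v hv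
    simp only [Finset.mem_coe, mem_Om] at hv
    simp only [Finset.mem_coe, mem_lev]
    rw [finrank_span_eq_card hv]; simp
  have h3 : ((Om K V (Fin k)).card : ℤ) = (lev K V k).card * PP (Fintype.card K) k k := by
    rw [h2]; push_cast
    rw [Finset.sum_congr rfl (fun S hS => card_bas (mem_lev.1 hS))]
    simp
  have h4 := gb_formula (Fintype.card K) (finrank K V) k
  have h5 : ((lev K V k).card : ℤ) = gbinom (Fintype.card K) (finrank K V) k := by
    apply mul_right_cancel₀ (PP_pos hq (le_refl k)).ne'
    rw [h4, ← h3, h1]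
  exact_mod_cast h5

theorem up_deg {k : ℕ} {S : Submodule K V} (hS : finrank K S = k) :
    (up k {S}).card = gbinom (Fintype.card K) (finrank K V - k) 1 := by
  classical
  have : Finite (V ⧸ S) := Quotient.finite _
  have : Fintype (V ⧸ S) := Fintype.ofFinite _
  have : Fintype (Submodule K (V ⧸ S)) := Fintype.ofFinite _
  have hd : finrank K (V ⧸ S) = finrank K V - k := by
    have := Submodule.finrank_quotient_add_finrank S; omega
  by_cases hk : k < finrank K V
  · rw [← hd, ← card_lev (K := K) (V := V ⧸ S) (k := 1) (by omega)]
    have hcm : ∀ P : Submodule K (V ⧸ S), finrank K (P.comap S.mkQ) = finrank K P + k := by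
      intro P
      have h := LinearMap.finrank_range_add_finrank_ker (S.mkQ.domRestrict (P.comap S.mkQ))
      rw [LinearMap.range_domRestrict, Submodule.map_comap_eq_of_surjective (Submodule.mkQ_surjective S),
        LinearMap.ker_domRestrict, Submodule.ker_mkQ] at h
      have h2 : finrank K (Submodule.comap (P.comap S.mkQ).subtype S) = k := by
        rw [← hS]
        exact (Submodule.comapSubtypeEquivOfLe (Submodule.le_comap_mkQ S P)).finrank_eq
      rw [h2] at h
      exact h.symm
    symm
    apply Finset.card_bij (fun P _ => P.comap S.mkQ)
    · intro P hP
      rw [mem_lev] at hP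
      rw [mem_up]
      refine ⟨by rw [hcm, hP]; omega, S, by simp, Submodule.le_comap_mkQ S P⟩
    · intro P _ Q _ h
      exact Submodule.comap_injective_of_surjective (Submodule.mkQ_surjective S) h
    · intro Y hY
      simp only [mem_up, Finset.mem_singleton, exists_eq_left] at hY
      have e : (Y.map S.mkQ).comap S.mkQ = Y := by
        rw [Submodule.comap_map_mkQ]; exact sup_eq_right.2 hY.2
      refine ⟨Y.map S.mkQ, ?_, e⟩
      have := hcm (Y.map S.mkQ)
      rw [e] at this
      rw [mem_lev]; omega
  · have : finrank K V - k = 0 := by omega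
    rw [this]
    simp only [gbinom]
    rw [Finset.card_eq_zero, Finset.eq_empty_iff_forall_notMem]
    intro Y hY
    rw [mem_up] at hY
    have := Submodule.finrank_le Y
    omega

theorem exists_move {S T : Submodule K V} (h : finrank K S = finrank K T) :
    ∃ g : V ≃ₗ[K] V, S.map (g : V →ₗ[K] V) = T := by
  obtain ⟨g, hg⟩ := Submodule.exists_linearEquiv_restrict_eq (LinearEquiv.ofFinrankEq S T h)
  refine ⟨g, ?_⟩
  apply Submodule.eq_of_le_of_finrank_eq
  · rintro _ ⟨x, hx, rfl⟩
    have := hg ⟨x, hx⟩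
    change g x ∈ T
    rw [← this]; exact Subtype.mem _
  · rw [← h]; exact LinearEquiv.finrank_map_eq g S

open Classical in
theorem equi {ι : Type*} [Fintype ι] (I : Set ι) [Fintype I] {k : ℕ} (hI : Fintype.card I = k) 
    (A : Finset (Submodule K V)) (hA : A ⊆ lev K V k) :
    (lev K V k).card * ((Om K V ι).filter (fun v => Submodule.span K (v '' I) ∈ A)).card
      = A.card * (Om K V ι).card := by
  have hc : ∀ S ∈ lev K V k, ∀ T ∈ lev K V k, 
      ((Om K V ι).filter (fun v => Submodule.span K (v '' I) = S)).card =
      ((Om K V ι).filter (fun v => Submodule.span K (v '' I) = T)).card := by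
    intro S hS T hT
    rw [mem_lev] at hS hT
    obtain ⟨g, hg⟩ := exists_move (hS.trans hT.symm)
    apply Finset.card_bij (fun v _ => fun i => g (v i))
    · intro v hv
      simp only [Finset.mem_filter, mem_Om] at hv ⊢
      refine ⟨hv.1.map' (g : V →ₗ[K] V) (by simp), ?_⟩
      rw [← hg, ← hv.2, Submodule.map_span, Set.image_image]
      rfl
    · intro v _ w _ h
      funext i
      exact g.injective (congrFun h i)
    · intro w hw
      simp only [Finset.mem_filter, mem_Om] at hw
      refine ⟨fun i => g.symm (w i), ?_, by simp⟩
      simp only [Finset.mem_filter, mem_Om]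
      refine ⟨hw.1.map' (g.symm : V →ₗ[K] V) (by simp), ?_⟩
      apply Submodule.map_injective_of_injective (f := (g : V →ₗ[K] V)) g.injective
      rw [hg, ← hw.2, Submodule.map_span, Set.image_image]
      simp
  obtain ⟨c, hc⟩ : ∃ c, ∀ S ∈ lev K V k,
      ((Om K V ι).filter (fun v => Submodule.span K (v '' I) = S)).card = c := by
    by_cases h : ∃ S, S ∈ lev K V k
    · obtain ⟨S, hS⟩ := h
      exact ⟨_, fun T hT => hc T hT S hS⟩
    · exact ⟨0, fun S hS => (h ⟨S, hS⟩).elim⟩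
  have key : ∀ B ⊆ lev K V k, 
      ((Om K V ι).filter (fun v => Submodule.span K (v '' I) ∈ B)).card = B.card * c := by
    intro B hB
    rw [Finset.card_eq_sum_card_fiberwise (f := fun v => Submodule.span K (v '' I)) (t := B)]
    · rw [← smul_eq_mul, ← Finset.sum_const]
      apply Finset.sum_congr rfl
      intro S hS
      rw [← hc S (hB hS), Finset.filter_filter]
      congr 1
      apply Finset.filter_congr
      intro v _
      constructor
      · rintro ⟨_, h⟩; exact h
      · intro h; exact ⟨by rw [h]; exact hS, h⟩
    · intro v hv
      simp only [Finset.coe_filter, Set.mem_ofPred_eq] at hv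
      exact hv.2
  have h1 := key _ (le_refl _)
  have h2 := key A hA
  rw [Finset.filter_true_of_mem] at h1
  · rw [h2, h1]; ring
  · intro v hv
    rw [mem_Om] at hv
    rw [mem_lev, Set.image_eq_range, ← hI]
    exact finrank_span_eq_card (hv.comp (Subtype.val : I → ι) Subtype.val_injective)

theorem span_finrank {ι : Type*} [Fintype ι] {v : ι → V} (hv : v ∈ Om K V ι) (I : Set ι) [Fintype I] :
    finrank K (Submodule.span K (v '' I)) = Fintype.card I := by
  rw [mem_Om] at hv
  rw [Set.image_eq_range]
  exact finrank_span_eq_card (hv.comp (Subtype.val : I → ι) Subtype.val_injective)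

theorem step_up {ι : Type*} [Fintype ι] {v : ι → V} (hv : v ∈ Om K V ι) {I J : Set ι} [Fintype J]
    (hIJ : I ⊆ J) {k : ℕ} (hJ : Fintype.card J = k + 1) {A : Finset (Submodule K V)}
    (h : Submodule.span K (v '' I) ∈ A) : Submodule.span K (v '' J) ∈ up k A := by
  rw [mem_up]
  exact ⟨by rw [span_finrank hv, hJ], _, h, Submodule.span_mono (Set.image_mono hIJ)⟩

theorem up_sub {k : ℕ} (A : Finset (Submodule K V)) : up k A ⊆ lev K V (k+1) := by
  intro Y hY
  rw [mem_up] at hY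
  rw [mem_lev]; exact hY.1

theorem Om_pos {k : ℕ} (hk : k ≤ finrank K V) : 0 < (Om K V (Fin k)).card := by
  have hq : 2 ≤ Fintype.card K := Fintype.one_lt_card
  have := card_Om (K := K) (V := V) hk
  have h2 := PP_pos hq hk
  rw [← this] at h2
  exact_mod_cast h2

theorem nm {k : ℕ} (hk : k + 1 ≤ finrank K V) {A : Finset (Submodule K V)} (hA : A ⊆ lev K V k) :
    A.card * (lev K V (k+1)).card ≤ (up k A).card * (lev K V k).card := by
  classical
  have h1 := equi (K := K) (V := V) (ι := Fin (k+1)) {i | i ≠ Fin.last k} (k := k) (by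
    simp only [Set.mem_ofPred_eq, Fintype.card_subtype]
    rw [Finset.filter_ne']; simp) A hA
  have h2 := equi (K := K) (V := V) (ι := Fin (k+1)) Set.univ (k := k+1) (by simp) (up k A) (up_sub A)
  have h3 : ((Om K V (Fin (k+1))).filter (fun v => Submodule.span K (v '' {i | i ≠ Fin.last k}) ∈ A)).card
      ≤ ((Om K V (Fin (k+1))).filter (fun v => Submodule.span K (v '' Set.univ) ∈ up k A)).card := by
    apply Finset.card_le_card
    intro v hv
    rw [Finset.mem_filter] at hv ⊢
    exact ⟨hv.1, step_up hv.1 (Set.subset_univ _) (by simp) hv.2⟩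
  have h4 := Om_pos (K := K) (V := V) hk
  apply Nat.le_of_mul_le_mul_right _ h4
  calc _ = (lev K V (k+1)).card * (A.card * (Om K V (Fin (k+1))).card) := by ring
    _ ≤ (lev K V k).card * ((up k A).card * (Om K V (Fin (k+1))).card) := by
      rw [← h1, ← h2]
      calc _ = ((lev K V (k+1)).card * (lev K V k).card) * _ := (mul_assoc _ _ _).symm
        _ ≤ ((lev K V (k+1)).card * (lev K V k).card) * _ := Nat.mul_le_mul_left _ h3
        _ = _ := by ring
    _ = _ := by ring

theorem cauchy {k : ℕ} {A : Finset (Submodule K V)} (hA : A ⊆ lev K V k) (hne : A.Nonempty) :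
    (A.card : ℤ) * (gbinom (Fintype.card K) (finrank K V - k) 1 : ℤ)^2 ≤
      (up k A).card * ((gbinom (Fintype.card K) (finrank K V - k) 1 : ℤ) + A.card - 1) := by
  classical
  set d := gbinom (Fintype.card K) (finrank K V - k) 1 with hd
  have hfil : ∀ S ∈ A, (up k A).filter (fun Y => S ≤ Y) = up k {S} := by
    intro S hS
    ext Y
    simp only [Finset.mem_filter, mem_up, Finset.mem_singleton, exists_eq_left]
    exact ⟨fun h => ⟨h.1.1, h.2⟩, fun h => ⟨⟨h.1, S, hS, h.2⟩, h.2⟩⟩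
  have hdeg : ∀ S ∈ A, ((up k A).filter (fun Y => S ≤ Y)).card = d := by
    intro S hS
    rw [hfil S hS, up_deg (mem_lev.1 (hA hS))]
  let f : Submodule K V → ℤ := fun Y => ∑ S ∈ A, if S ≤ Y then 1 else 0
  have hs1 : ∑ Y ∈ up k A, f Y = A.card * d := by
    simp only [f]
    rw [Finset.sum_comm]
    have : ∀ S ∈ A, (∑ Y ∈ up k A, if S ≤ Y then (1:ℤ) else 0) = d := by
      intro S hS
      rw [← hdeg S hS]; simp
    rw [Finset.sum_congr rfl this]; simp
  have hs2 : ∑ Y ∈ up k A, f Y ^ 2 ≤ A.card * (d + A.card - 1) := by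
    have e : ∀ Y, f Y ^ 2 = ∑ S ∈ A, ∑ T ∈ A, if S ≤ Y ∧ T ≤ Y then 1 else 0 := by
      intro Y
      simp only [f]
      rw [sq, Finset.sum_mul_sum]
      apply Finset.sum_congr rfl; intro S _
      apply Finset.sum_congr rfl; intro T _
      by_cases h1 : S ≤ Y <;> by_cases h2 : T ≤ Y <;> simp [h1, h2]
    simp only [e]
    rw [Finset.sum_comm]
    have : ∀ S ∈ A, (∑ Y ∈ up k A, ∑ T ∈ A, if S ≤ Y ∧ T ≤ Y then (1:ℤ) else 0) ≤ d + A.card - 1 := by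
      intro S hS
      rw [Finset.sum_comm]
      have b : ∀ T ∈ A, (∑ Y ∈ up k A, if S ≤ Y ∧ T ≤ Y then (1:ℤ) else 0) ≤
          1 + if T = S then (d:ℤ) - 1 else 0 := by
        intro T hT
        split_ifs with h
        · subst h
          simp only [and_self]
          rw [← hdeg T hT]; simp
        · simp only [Finset.sum_boole, add_zero]
          have : ((up k A).filter (fun Y => S ≤ Y ∧ T ≤ Y)).card ≤ 1 := by
            rw [Finset.card_le_one]
            have hST : ∀ Y ∈ (up k A).filter (fun Y => S ≤ Y ∧ T ≤ Y), Y = S ⊔ T := by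
              intro Y hY
              simp only [Finset.mem_filter, mem_up] at hY
              symm
              apply Submodule.eq_of_le_of_finrank_le (sup_le hY.2.1 hY.2.2)
              rw [hY.1.1]
              have h1 := mem_lev.1 (hA hS)
              have h2 := mem_lev.1 (hA hT)
              have : S < S ⊔ T := by
                rw [left_lt_sup]
                intro hle
                exact h (Submodule.eq_of_le_of_finrank_eq hle (by rw [h1, h2]))
              have := Submodule.finrank_lt_finrank_of_lt this
              omega
            intro Y hY Z hZ
            rw [hST Y hY, hST Z hZ]
          exact_mod_cast this
      refine (Finset.sum_le_sum b).trans ?_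
      rw [Finset.sum_add_distrib, Finset.sum_ite_eq']
      simp [hS]; linarith
    refine (Finset.sum_le_sum this).trans ?_
    rw [Finset.sum_const, nsmul_eq_mul]
  have hcs := sq_sum_le_card_mul_sum_sq (s := up k A) (f := f)
  rw [hs1] at hcs
  have ha : (0:ℤ) < A.card := by exact_mod_cast hne.card_pos
  have h3 := mul_le_mul_of_nonneg_left hs2 (Int.natCast_nonneg (up k A).card)
  apply le_of_mul_le_mul_left _ ha
  linarith

theorem small_case {a d u : ℤ} (ha : 1 ≤ a) (hd : 1 ≤ d) (h : a * d^2 ≤ u * (d + a - 1)) 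
    (h2 : a < (d-1)^2) : u ≥ a + d - 1 ∧ (u = a + d - 1 → a = 1) := by
  have hp : 0 < d + a - 1 := by linarith
  have key : (a-1) * ((d-1)^2 - a) ≤ (u - (a + d - 1)) * (d+a-1) := by nlinarith
  have h3 : 0 ≤ (a-1) * ((d-1)^2 - a) := mul_nonneg (by linarith) (by linarith)
  constructor
  · by_contra hc
    push Not at hc
    have : (u - (a + d - 1)) * (d+a-1) < 0 := mul_neg_of_neg_of_pos (by linarith) hp
    linarith
  · intro hu
    rw [hu] at key
    by_contra hc
    have h1 : 0 < (a-1) := by omega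
    have : 0 < (a-1) * ((d-1)^2 - a) := mul_pos h1 (by linarith)
    linarith

/-- pushing up from a level below the middle -/
theorem push_level {k : ℕ} (hk : 2 * k + 2 ≤ finrank K V) {A : Finset (Submodule K V)} (hA : A ⊆ lev K V k)
    (hne : A.Nonempty) :
    A.card + Fintype.card K * gbinom (Fintype.card K) (finrank K V - k - 1) 1 ≤ (up k A).card ∧
    ((up k A).card = A.card + Fintype.card K * gbinom (Fintype.card K) (finrank K V - k - 1) 1 → A.card = 1) := by
  have hq : 2 ≤ Fintype.card K := Fintype.one_lt_card
  set q := Fintype.card K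
  have hc := cauchy hA hne
  have ha : 1 ≤ A.card := hne.card_pos
  obtain ⟨j, hj⟩ : ∃ j, finrank K V - k = j + 1 := ⟨finrank K V - k - 1, by omega⟩
  have hj' : finrank K V - k - 1 = j := by omega
  have hd : gbinom q (finrank K V - k) 1 = 1 + q * gbinom q j 1 := by rw [hj, gb_one_succ]
  rw [hj']
  have hn := nm (by omega) hA
  have hr := gb_ratio hq (n := finrank K V) (k := k) (by omega)
  rw [card_lev (by omega), card_lev (by omega)] at hn
  rw [hd] at hr hc
  have hjk : gbinom q (k+1) 1 ≤ gbinom q j 1 := gb_one_mono hq (by omega)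
  have hk1 : 0 < gbinom q (k+1) 1 := gb_one_pos (by omega)
  have hN : 0 < gbinom q (finrank K V) k := gb_pos hq (by omega)
  set N := gbinom q (finrank K V) k
  set N' := gbinom q (finrank K V) (k+1)
  set e := gbinom q (k+1) 1
  set g := gbinom q j 1
  set a := A.card
  set u := (up k A).card
  have hae : a * (1 + q * g) ≤ u * e := by
    apply Nat.le_of_mul_le_mul_left _ hN
    calc N * (a * (1 + q * g)) = a * (N * (1 + q * g)) := by ring
      _ = a * N' * e := by rw [← hr]; ring
      _ ≤ u * N * e := Nat.mul_le_mul_right _ hn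
      _ = _ := by ring
  by_cases hs : a < (q * g)^2
  · have := small_case (a := a) (d := 1 + q * g) (u := u) (by exact_mod_cast ha)
      (by have : (0:ℤ) ≤ q * g := by positivity
          linarith)
      (by push_cast at hc; exact hc) (by 
        have : ((1:ℤ) + q * g - 1) = ((q * g : ℕ):ℤ) := by push_cast; ring
        rw [this]; exact_mod_cast hs)
    obtain ⟨h1, h2⟩ := this
    constructor
    · zify; linarith
    · intro h
      have := h2 (by rw [h]; push_cast; ring)
      exact_mod_cast this
  · push Not at hs
    have h2 : 2 * a < u := by
      by_contra hcon
      push Not at hcon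
      have : u * e ≤ 2 * a * g := Nat.mul_le_mul hcon hjk
      have h3 : a * (2 * g) ≤ a * (q * g) := Nat.mul_le_mul_left _ (Nat.mul_le_mul_right _ hq)
      nlinarith
    have h3 : q * g ≤ (q*g)^2 := by nlinarith [Nat.zero_le (q*g)]
    constructor
    · omega
    · omega

theorem card_win {N i c : ℕ} (h : i + c ≤ N) [Fintype {j : Fin N | i ≤ (j:ℕ) ∧ (j:ℕ) < i + c}] :
    Fintype.card {j : Fin N | i ≤ (j:ℕ) ∧ (j:ℕ) < i + c} = c := by
  have e : {j : Fin N | i ≤ (j:ℕ) ∧ (j:ℕ) < i + c} ≃ Fin c :=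
    { toFun := fun j => ⟨(j.1:ℕ) - i, by have := j.2; simp only [Set.mem_ofPred_eq] at this; omega⟩
      invFun := fun x => ⟨⟨i + x, by omega⟩, by simp⟩
      left_inv := by
        rintro ⟨j, hj⟩
        simp only [Set.mem_ofPred_eq] at hj
        apply Subtype.ext; apply Fin.ext; simp; omega
      right_inv := by
        intro x; apply Fin.ext; simp }
  rw [Fintype.card_congr e, Fintype.card_fin]

theorem walk {m : ℕ} (hn : 2 * m + 1 ≤ finrank K V) {A : Finset (Submodule K V)} (hA : A ⊆ lev K V m)
    (hN : (lev K V (m+1)).card = (lev K V m).card) :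
    (A.card : ℤ) * (Om K V (Fin (m+m))).card ≤
      (lev K V m).card * ((A.card:ℤ) * PP (Fintype.card K) m m)^2 
      + m * (((up m A).card : ℤ) - A.card) * (Om K V (Fin (m+m))).card := by
  classical
  let I : ℕ → Set (Fin (m+m)) := fun i => {j | i ≤ (j:ℕ) ∧ (j:ℕ) < i + m}
  let J : ℕ → Set (Fin (m+m)) := fun i => {j | i ≤ (j:ℕ) ∧ (j:ℕ) < i + (m+1)}
  let T : ℕ → Finset (Fin (m+m) → V) := fun i =>
    (Om K V (Fin (m+m))).filter (fun v => Submodule.span K (v '' (I i)) ∈ A)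
  let U : ℕ → Finset (Fin (m+m) → V) := fun i =>
    (Om K V (Fin (m+m))).filter (fun v => Submodule.span K (v '' (J i)) ∈ up m A)
  have hT : ∀ i ≤ m, (lev K V m).card * (T i).card = A.card * (Om K V (Fin (m+m))).card := by
    intro i hi
    exact equi (I i) (card_win (by omega)) A hA
  have hU : ∀ i < m, (lev K V m).card * (U i).card = (up m A).card * (Om K V (Fin (m+m))).card := by
    intro i hi
    rw [← hN]
    exact equi (J i) (card_win (by omega)) (up m A) (up_sub A)
  have hTU : ∀ i < m, T i ⊆ U i := by
    intro i hi v hv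
    simp only [T, U, Finset.mem_filter] at hv ⊢
    refine ⟨hv.1, step_up hv.1 ?_ (card_win (by omega)) hv.2⟩
    intro j hj; simp only [I, Set.mem_ofPred_eq] at hj ⊢; omega
  have hTU' : ∀ i < m, T (i+1) ⊆ U i := by
    intro i hi v hv
    simp only [T, U, Finset.mem_filter] at hv ⊢
    refine ⟨hv.1, step_up hv.1 ?_ (card_win (by omega)) hv.2⟩
    intro j hj; simp only [I, Set.mem_ofPred_eq] at hj ⊢; omega
  have hstep : ∀ i ≤ m, (lev K V m).card * ((T 0 \ T i).card : ℤ) ≤ 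
      i * (((up m A).card : ℤ) - A.card) * (Om K V (Fin (m+m))).card := by
    intro i
    induction i with
    | zero => intro _; simp
    | succ i ih =>
      intro hi
      have h1 := ih (by omega)
      have h2 : T 0 \ T (i+1) ⊆ (T 0 \ T i) ∪ (U i \ T (i+1)) := by
        intro v hv
        have := hTU i (by omega)
        simp only [Finset.mem_union, Finset.mem_sdiff] at hv ⊢
        by_cases h : v ∈ T i
        · exact Or.inr ⟨this h, hv.2⟩
        · exact Or.inl ⟨hv.1, h⟩
      have h3 := (Finset.card_le_card h2).trans (Finset.card_union_le _ _)
      have h4 := Finset.card_sdiff_add_card_eq_card (hTU' i (by omega))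
      have h5 := hT (i+1) hi
      have h6 := hU i (by omega)
      zify at h3 h4 h5 h6
      have h7 := mul_le_mul_of_nonneg_left h3 (Int.natCast_nonneg (lev K V m).card)
      push_cast
      nlinarith
  -- both ends
  let B : Finset (Fin m → V) := (Om K V (Fin m)).filter (fun v => Submodule.span K (Set.range v) ∈ A)
  have hB : (B.card : ℤ) = A.card * PP (Fintype.card K) m m := by
    rw [Finset.card_eq_sum_card_fiberwise (f := fun v => Submodule.span K (Set.range v)) (t := A)]
    · push_cast
      rw [← nsmul_eq_mul, ← Finset.sum_const]
      apply Finset.sum_congr rfl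
      intro S hS
      rw [← card_bas (mem_lev.1 (hA hS)), Finset.filter_filter]
      congr 2
      apply Finset.filter_congr
      intro v _
      constructor
      · rintro ⟨_, h⟩; exact h
      · intro h; exact ⟨by rw [h]; exact hS, h⟩
    · intro v hv
      simp only [B, Finset.coe_filter, Set.mem_ofPred_eq] at hv
      exact hv.2
  have hends : (T 0 ∩ T m).card ≤ (B ×ˢ B).card := by
    apply Finset.card_le_card_of_injOn (fun v => (fun j => v (Fin.castAdd m j), fun j => v (Fin.natAdd m j)))
    · intro v hv
      simp only [T, Finset.coe_inter, Finset.coe_filter, mem_Om] at hv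
      simp only [B, Finset.coe_product, Finset.coe_filter, mem_Om]
      have e1 : v '' I 0 = Set.range (fun j => v (Fin.castAdd m j)) := by
        ext x; constructor
        · rintro ⟨j, hj, rfl⟩
          simp only [I, Set.mem_ofPred_eq] at hj
          exact ⟨⟨j, by omega⟩, rfl⟩
        · rintro ⟨j, rfl⟩
          exact ⟨_, by simp [I], rfl⟩
      have e2 : v '' I m = Set.range (fun j => v (Fin.natAdd m j)) := by
        ext x; constructor
        · rintro ⟨j, hj, rfl⟩
          simp only [I, Set.mem_ofPred_eq] at hj
          refine ⟨⟨j - m, by omega⟩, ?_⟩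
          have : Fin.natAdd m (⟨j - m, by omega⟩ : Fin m) = j := by apply Fin.ext; simp; omega
          simp only [this]
        · rintro ⟨j, rfl⟩
          exact ⟨_, by simp [I], rfl⟩
      obtain ⟨⟨h1, h2⟩, ⟨_, h3⟩⟩ := hv
      rw [e1] at h2
      rw [e2] at h3
      exact ⟨⟨h1.comp _ (Fin.castAdd_injective m m), h2⟩, ⟨h1.comp _ (Fin.natAdd_injective m m), h3⟩⟩
    · intro v _ w _ h
      simp only [Prod.mk.injEq] at h
      funext j
      refine Fin.addCases (fun i => ?_) (fun i => ?_) j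
      · exact congrFun h.1 i
      · exact congrFun h.2 i
  have h1 := hstep m le_rfl
  have h2 := hT 0 (by omega)
  have h3 := Finset.card_sdiff_add_card_inter (T 0) (T m)
  rw [Finset.card_product] at hends
  zify at h2 h3 hends
  rw [hB] at hends
  have h7 := mul_le_mul_of_nonneg_left hends (Int.natCast_nonneg (lev K V m).card)
  nlinarith

/-- product counting extensions -/
def P2 (q m : ℕ) : ℤ := ∏ i ∈ Finset.range m, ((q : ℤ) ^ (2*m+1) - (q : ℤ) ^ (m+i))

theorem PP_split (q m : ℕ) : PP q (2*m+1) (m+m) = PP q (2*m+1) m * P2 q m := by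
  unfold PP P2
  rw [Finset.prod_range_add]

theorem half_prod (m : ℕ) (hm : 1 ≤ m) : (3/4 : ℝ) * (3/4 + (1/2)^(m+1)) ≤ ∏ j ∈ Finset.range m, (1 - (1/2 : ℝ)^(j+2)) := by
  induction m, hm using Nat.le_induction with
  | base => norm_num
  | succ m hm ih =>
    rw [Finset.prod_range_succ]
    have hy : (1/2:ℝ)^(m+2) ≤ (1/2)^(1+2) := pow_le_pow_of_le_one (by norm_num) (by norm_num) (by omega)
    have e : (1/2:ℝ)^(m+1) = 2 * (1/2)^(m+2) := by rw [pow_succ _ (m+1)]; ring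
    have hy0 : (0:ℝ) < (1/2)^(m+2) := by positivity
    rw [e] at ih
    have e2 : m + 1 + 1 = m + 2 := rfl
    rw [e2]
    set y := (1/2:ℝ)^(m+2)
    have h1 : 0 ≤ 1 - y := by norm_num at hy; linarith
    refine le_trans ?_ (mul_le_mul_of_nonneg_right ih h1)
    norm_num at hy
    nlinarith

theorem ratio_bd {q m : ℕ} (hq : 2 ≤ q) (hm : 1 ≤ m) : 9 * PP q (2*m+1) m ≤ 16 * P2 q m := by
  have hq' : (2:ℝ) ≤ q := by exact_mod_cast hq
  have h1 : ∏ i ∈ Finset.range m, ((1 - (1/2:ℝ)^(m-1-i+2)) * ((q:ℝ)^(2*m+1) - (q:ℝ)^i)) ≤ 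
      ∏ i ∈ Finset.range m, ((q:ℝ)^(2*m+1) - (q:ℝ)^(m+i)) := by
    apply Finset.prod_le_prod
    · intro i hi
      have hi' : i < m := Finset.mem_range.1 hi
      apply mul_nonneg
      · have : (1/2:ℝ)^(m-1-i+2) ≤ 1 := pow_le_one₀ (by norm_num) (by norm_num)
        linarith
      · have : (q:ℝ)^i ≤ (q:ℝ)^(2*m+1) := pow_le_pow_right₀ (by linarith) (by omega)
        linarith
    · intro i hi
      have hi' : i < m := Finset.mem_range.1 hi
      obtain ⟨s, hs⟩ : ∃ s, m = i + 1 + s := ⟨m - i - 1, by omega⟩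
      have e1 : m - 1 - i + 2 = s + 2 := by omega
      have e2 : 2*m+1 = (m+i) + (s+2) := by omega
      rw [e1]
      have h0 : (1/2:ℝ)^(s+2) ≤ 1 := pow_le_one₀ (by norm_num) (by norm_num)
      have h2 : (1:ℝ) ≤ (1/2:ℝ)^(s+2) * (q:ℝ)^(s+2) := by
        rw [← mul_pow]; exact one_le_pow₀ (by linarith)
      have h3 : (0:ℝ) < (q:ℝ)^i := by positivity
      have h4 : (0:ℝ) < (q:ℝ)^(m+i) := by positivity
      have h5 : (q:ℝ)^(m+i) ≤ (1/2:ℝ)^(s+2) * (q:ℝ)^(2*m+1) := by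
        rw [e2, pow_add _ (m+i)]; nlinarith
      nlinarith
  rw [Finset.prod_mul_distrib] at h1
  have h2 := half_prod m hm
  rw [← Finset.prod_range_reflect] at h2
  have hP : (0:ℝ) < ∏ i ∈ Finset.range m, ((q:ℝ)^(2*m+1) - (q:ℝ)^i) := by
    have := PP_pos hq (n := 2*m+1) (k := m) (by omega)
    unfold PP at this
    exact_mod_cast this
  have h3 : (0:ℝ) < (1/2)^(m+1) := by positivity
  have h4 : (9 / 16 : ℝ) * ∏ i ∈ Finset.range m, ((q:ℝ)^(2*m+1) - (q:ℝ)^i) ≤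
      ∏ i ∈ Finset.range m, ((q:ℝ)^(2*m+1) - (q:ℝ)^(m+i)) := by
    refine le_trans (mul_le_mul_of_nonneg_right ?_ hP.le) h1
    refine le_trans ?_ h2
    nlinarith
  have h5 : (9:ℝ) * ∏ i ∈ Finset.range m, ((q:ℝ)^(2*m+1) - (q:ℝ)^i) ≤
      16 * ∏ i ∈ Finset.range m, ((q:ℝ)^(2*m+1) - (q:ℝ)^(m+i)) := by linarith
  unfold PP P2
  exact_mod_cast h5

theorem gen_bd {q m : ℕ} (hq : 2 ≤ q) : (q:ℤ)^((m+1)*m) * PP q m m ≤ P2 q m := by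
  unfold PP P2
  rw [pow_mul]
  have e : ((q:ℤ)^(m+1))^m = ∏ i ∈ Finset.range m, (q:ℤ)^(m+1) := by simp
  rw [e, ← Finset.prod_mul_distrib]
  have hq' : (2:ℤ) ≤ q := by exact_mod_cast hq
  apply Finset.prod_le_prod
  · intro i hi
    have hi' : i < m := Finset.mem_range.1 hi
    have : (q:ℤ)^i ≤ (q:ℤ)^m := pow_le_pow_right₀ (by linarith) (by omega)
    exact mul_nonneg (by positivity) (by linarith)
  · intro i hi
    have : (q:ℤ)^(m+i) ≤ (q:ℤ)^(m+1+i) := pow_le_pow_right₀ (by linarith) (by omega)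
    have e1 : (q:ℤ)^(2*m+1) = (q:ℤ)^(m+1) * (q:ℤ)^m := by rw [← pow_add]; congr 1; omega
    have e2 : (q:ℤ)^(m+1+i) = (q:ℤ)^(m+1) * (q:ℤ)^i := by rw [← pow_add]
    rw [e1]
    rw [e2] at this
    linarith

theorem gb_lb {q m : ℕ} (hq : 2 ≤ q) (hm : 2 ≤ m) : m + 1 ≤ gbinom q m 1 := by
  induction m, hm using Nat.le_induction with
  | base => simp [gbinom]; omega
  | succ m hm ih => rw [gb_one_succ]; nlinarith

theorem pow_lb {q m : ℕ} (hq : 2 ≤ q) (hm : 2 ≤ m) (hne : ¬ (q = 2 ∧ m = 2)) : 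
    81 * (m:ℤ) * (q:ℤ)^(m+1) < 8 * (q:ℤ)^((m+1)*m) := by
  have hq' : (2:ℤ) ≤ q := by exact_mod_cast hq
  have e : (q:ℤ)^((m+1)*m) = (q:ℤ)^((m+1)*(m-1)) * (q:ℤ)^(m+1) := by
    rw [← pow_add]; congr 1
    obtain ⟨s, rfl⟩ : ∃ s, m = s + 1 := ⟨m-1, by omega⟩
    simp; ring
  rw [e]
  have : 81 * (m:ℤ) < 8 * (q:ℤ)^((m+1)*(m-1)) := by
    by_cases h : m = 2
    · subst h
      have h3 : (3:ℤ) ≤ q := by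
        have : 3 ≤ q := by omega
        exact_mod_cast this
      have : (3:ℤ)^3 ≤ (q:ℤ)^3 := pow_le_pow_left₀ (by norm_num) h3 3
      norm_num at this ⊢
      linarith
    · obtain ⟨s, rfl⟩ : ∃ s, m = s + 3 := ⟨m-3, by omega⟩
      have h1 : (2:ℤ)^(2*(s+4)) ≤ (q:ℤ)^((s+3+1)*(s+3-1)) := by
        calc (2:ℤ)^(2*(s+4)) ≤ (2:ℤ)^((s+3+1)*(s+3-1)) := by
              apply pow_le_pow_right₀ (by norm_num)
              have : s + 3 - 1 = s + 2 := by omega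
              rw [this]; nlinarith
          _ ≤ _ := pow_le_pow_left₀ (by norm_num) hq' _
      have h2 : (1:ℤ) + (s:ℤ) * 3 ≤ 4^s := by
        have := one_add_mul_le_pow (a := (3:ℤ)) (by norm_num) s
        norm_num at this; linarith
      have h3 : (2:ℤ)^(2*(s+4)) = 256 * 4^s := by
        rw [pow_mul, pow_add]; norm_num; ring
      push_cast
      have e4 : s + 3 - 1 = s + 2 := by omega
      rw [h3, e4] at h1
      linarith
  have h5 : (0:ℤ) < (q:ℤ)^(m+1) := by positivity
  nlinarith

theorem big_case {q m : ℕ} (hq : 2 ≤ q) (hm : 2 ≤ m) {a u : ℤ} 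
    (ha : ((q:ℤ) * gbinom q m 1)^2 ≤ a) (hN : 2 * a * PP q m m ≤ PP q (2*m+1) m)
    (hw : a * P2 q m ≤ a * (a * PP q m m) + m * (u - a) * P2 q m) :
    a + q * gbinom q m 1 < u := by
  by_contra hcon
  push Not at hcon
  by_cases hex : q = 2 ∧ m = 2
  · obtain ⟨rfl, rfl⟩ := hex
    simp [PP, P2, Finset.prod_range_succ, gbinom] at *
    have : a ≤ 77 := by omega
    nlinarith
  have hβ := PP_pos hq (le_refl m)
  have h1 := ratio_bd hq (by omega : 1 ≤ m)
  have h2 := gen_bd (m := m) hq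
  have h3 := pow_lb hq hm hex
  have hg := gb_lb hq hm
  have hg1 := gb_one q m
  have hq' : (2:ℤ) ≤ q := by exact_mod_cast hq
  have hg' : (m:ℤ) + 1 ≤ gbinom q m 1 := by exact_mod_cast hg
  have hm' : (2:ℤ) ≤ m := by exact_mod_cast hm
  set g : ℤ := (gbinom q m 1 : ℤ)
  set β := PP q m m
  set p1 := PP q (2*m+1) m
  set p2 := P2 q m
  have hD : (q:ℤ) * g ≤ (q:ℤ)^(m+1) := by
    have : g ≤ (q:ℤ)^m := by nlinarith
    rw [pow_succ]; nlinarith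
  have hD2 : 2 * (m:ℤ) < q * g := by nlinarith
  set D := (q:ℤ) * g
  have hp2 : 0 < p2 := lt_of_lt_of_le (by positivity) h2
  have hx : 9 * (a * β) ≤ 8 * p2 := by nlinarith
  have hL : (u - a) ≤ D := by linarith
  have hw2 : a * p2 ≤ a * (a * β) + m * D * p2 := by
    have : (m:ℤ) * (u - a) * p2 ≤ m * D * p2 := by gcongr
    linarith
  have hapos : 0 < a := by nlinarith
  by_cases hc : 2 * (a * β) ≤ p2
  · have h5 : a * (2 * (a*β)) ≤ a * p2 := by gcongr
    have h6 : a * p2 ≤ (2 * m * D) * p2 := by linarith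
    have h7 := le_of_mul_le_mul_right h6 hp2
    nlinarith
  · push Not at hc
    set x := a * β
    have h5 : β * (a * p2) ≤ β * (a * x + m * D * p2) := by gcongr
    have h6 : x * (p2 - x) ≤ (m * D * β) * p2 := by
      have : x * (p2 - x) = β * (a * p2) - β * (a * x) := by simp only [x]; ring
      rw [this]; linarith
    have h7 : 8 * p2 * p2 ≤ 81 * (x * (p2 - x)) := by
      have := mul_nonneg (by linarith : 0 ≤ 9 * x - p2) (by linarith : 0 ≤ 8 * p2 - 9 * x)
      nlinarith
    have h8 : (8 * p2) * p2 ≤ (81 * m * D * β) * p2 := by linarith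
    have h9 := le_of_mul_le_mul_right h8 hp2
    have h10 : 81 * (m:ℤ) * D * β ≤ 81 * m * (q:ℤ)^(m+1) * β := by gcongr
    have h11 := mul_lt_mul_of_pos_right h3 hβ
    linarith

theorem mid_level {m : ℕ} (hm : 1 ≤ m) (hV : finrank K V = 2 * m + 1) {A : Finset (Submodule K V)}
    (hA : A ⊆ lev K V m) (hne : A.Nonempty)
    (hhalf : 2 * A.card ≤ gbinom (Fintype.card K) (2*m+1) m) :
    A.card + Fintype.card K * gbinom (Fintype.card K) m 1 ≤ (up m A).card ∧
    ((up m A).card = A.card + Fintype.card K * gbinom (Fintype.card K) m 1 → A.card = 1) := by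
  have hq : 2 ≤ Fintype.card K := Fintype.one_lt_card
  have hl := card_lev (K := K) (V := V) (k := m) (by omega)
  have hl' := card_lev (K := K) (V := V) (k := m+1) (by omega)
  have hc := cauchy hA hne
  have hM := card_Om (K := K) (V := V) (k := m+m) (by omega)
  have ha : 1 ≤ A.card := hne.card_pos
  have hr := gb_ratio hq (n := 2*m+1) (k := m) (by omega)
  have hw := walk (by omega) hA
  rw [hV] at hl hl' hc hM
  set q := Fintype.card K
  have e1 : 2 * m + 1 - m = m + 1 := by omega
  rw [e1] at hr hc
  have hN : gbinom q (2*m+1) (m+1) = gbinom q (2*m+1) m :=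
    Nat.eq_of_mul_eq_mul_right (gb_one_pos (q := q) (by omega : 0 < m+1)) hr
  replace hw := hw (by rw [hl, hl', hN])
  rw [hM, hl, PP_split] at hw
  have hf := gb_formula q (2*m+1) m
  rw [gb_one_succ] at hc
  have hNpos : 0 < gbinom q (2*m+1) m := gb_pos hq (by omega)
  set u := (up m A).card
  set a := A.card
  by_cases hs : a < (q * gbinom q m 1)^2
  · have := small_case (a := a) (d := 1 + q * gbinom q m 1) (u := u) (by exact_mod_cast ha)
      (by have : (0:ℤ) ≤ q * gbinom q m 1 := by positivity
          linarith)
      (by push_cast at hc; exact hc) (by 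
        have : ((1:ℤ) + q * gbinom q m 1 - 1) = ((q * gbinom q m 1 : ℕ):ℤ) := by push_cast; ring
        rw [this]; exact_mod_cast hs)
    obtain ⟨h1, h2⟩ := this
    constructor
    · zify; linarith
    · intro h
      have := h2 (by rw [h]; push_cast; ring)
      exact_mod_cast this
  · push Not at hs
    by_cases hm1 : m = 1
    · exfalso
      subst hm1
      simp [gbinom] at hs hhalf
      nlinarith
    · have hb := big_case hq (by omega : 2 ≤ m) (a := a) (u := u) (by exact_mod_cast hs)
        (by rw [← hf]
            have := PP_pos hq (le_refl m)
            have h2 : (2 * (a:ℤ)) ≤ gbinom q (2*m+1) m := by exact_mod_cast hhalf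
            exact mul_le_mul_of_nonneg_right h2 this.le)
        (by
          have hβ := PP_pos hq (le_refl m)
          rw [← hf] at hw
          have hN' : (0:ℤ) < gbinom q (2*m+1) m := by exact_mod_cast hNpos
          have hNb : (0:ℤ) < gbinom q (2*m+1) m * PP q m m := by positivity
          apply le_of_mul_le_mul_left _ hNb
          linarith)
      have hb' : a + q * gbinom q m 1 < u := by exact_mod_cast hb
      omega

/-- antichain -/
def AC {K V : Type*} [Field K] [AddCommGroup V] [Module K V] (F : Finset (Submodule K V)) : Prop :=
  ∀ A ∈ F, ∀ B ∈ F, A ≤ B → A = B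

theorem push_one {k : ℕ} (hk : 2 * k + 2 ≤ finrank K V) {F : Finset (Submodule K V)} (hF : AC F)
    (hlow : ∀ X ∈ F, k ≤ finrank K X) (hex : ∃ X ∈ F, finrank K X = k) :
    ∃ G : Finset (Submodule K V), AC G ∧ (∀ X ∈ G, k + 1 ≤ finrank K X) ∧
      (∃ X ∈ G, finrank K X = k + 1) ∧
      (∀ X ∈ G, X ∈ F ∨ finrank K X ≤ k + 1) ∧
      F.card + Fintype.card K * gbinom (Fintype.card K) (finrank K V - k - 1) 1 ≤ G.card ∧
      (G.card = F.card + Fintype.card K * gbinom (Fintype.card K) (finrank K V - k - 1) 1 →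
        ∃ U ∈ F, finrank K U = k ∧ ∀ X, X ∈ G ↔ ((X ∈ F ∧ X ≠ U) ∨ X ∈ up k {U})) := by
  classical
  set A := F.filter (fun X : Submodule K V => finrank K X = k) with hAdef
  have hAl : A ⊆ lev K V k := by
    intro X hX; rw [mem_lev]; exact (Finset.mem_filter.1 hX).2
  have hAne : A.Nonempty := by
    obtain ⟨X, hX, h⟩ := hex
    exact ⟨X, Finset.mem_filter.2 ⟨hX, h⟩⟩
  have hAF : A ⊆ F := Finset.filter_subset _ _
  obtain ⟨p1, p2⟩ := push_level hk hAl hAne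
  have hdisj : Disjoint (F \ A) (up k A) := by
    rw [Finset.disjoint_left]
    intro Z hZ hZ'
    rw [mem_up] at hZ'
    obtain ⟨_, S, hS, hSZ⟩ := hZ'
    rw [Finset.mem_sdiff] at hZ
    have := hF S (hAF hS) Z hZ.1 hSZ
    rw [this] at hS; exact hZ.2 hS
  have hcard : ((F \ A) ∪ up k A).card + A.card = F.card + (up k A).card := by
    rw [Finset.card_union_of_disjoint hdisj]
    have := Finset.card_sdiff_add_card_eq_card hAF
    omega
  have hgt : ∀ X ∈ F \ A, k + 1 ≤ finrank K X := by
    intro X hX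
    rw [Finset.mem_sdiff, hAdef, Finset.mem_filter] at hX
    have := hlow X hX.1
    have : finrank K X ≠ k := fun h => hX.2 ⟨hX.1, h⟩
    omega
  refine ⟨(F \ A) ∪ up k A, ?_, ?_, ?_, ?_, ?_, ?_⟩
  · intro X hX Y hY hXY
    rw [Finset.mem_union] at hX hY
    rcases hY with hY | hY
    · rcases hX with hX | hX
      · exact hF X (Finset.mem_sdiff.1 hX).1 Y (Finset.mem_sdiff.1 hY).1 hXY
      · exfalso
        obtain ⟨_, S, hS, hSX⟩ := mem_up.1 hX
        have := hF S (hAF hS) Y (Finset.mem_sdiff.1 hY).1 (hSX.trans hXY)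
        rw [this] at hS; exact (Finset.mem_sdiff.1 hY).2 hS
    · have h1 := (mem_up.1 hY).1
      have h2 : k + 1 ≤ finrank K X := by
        rcases hX with hX | hX
        · exact hgt X hX
        · exact (mem_up.1 hX).1.ge
      exact Submodule.eq_of_le_of_finrank_le hXY (by omega)
  · intro X hX
    rw [Finset.mem_union] at hX
    rcases hX with hX | hX
    · exact hgt X hX
    · exact (mem_up.1 hX).1.ge
  · have : 0 < (up k A).card := by have := hAne.card_pos; omega
    obtain ⟨Y, hY⟩ := Finset.card_pos.1 this
    exact ⟨Y, Finset.mem_union_right _ hY, (mem_up.1 hY).1⟩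
  · intro X hX
    rw [Finset.mem_union] at hX
    rcases hX with hX | hX
    · exact Or.inl (Finset.mem_sdiff.1 hX).1
    · exact Or.inr (mem_up.1 hX).1.le
  · omega
  · intro h
    obtain ⟨U, hU⟩ := Finset.card_eq_one.1 (p2 (by omega))
    have hUA : U ∈ A := by rw [hU]; simp
    refine ⟨U, hAF hUA, mem_lev.1 (hAl hUA), ?_⟩
    intro X
    rw [hU]; simp

theorem push_all {m : ℕ} (hm : 2 * m ≤ finrank K V) : ∀ j k, k + j + 1 = m →
    ∀ F : Finset (Submodule K V), AC F → (∀ X ∈ F, k ≤ finrank K X) → (∃ X ∈ F, finrank K X = k) →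
    ∃ G : Finset (Submodule K V), AC G ∧ (∀ X ∈ G, m ≤ finrank K X) ∧ (∀ X ∈ G, X ∈ F ∨ finrank K X ≤ m) ∧
      F.card + Fintype.card K * gbinom (Fintype.card K) (finrank K V - m) 1 ≤ G.card ∧
      (G.card = F.card + Fintype.card K * gbinom (Fintype.card K) (finrank K V - m) 1 →
        ∃ U ∈ F, finrank K U + 1 = m ∧ ∀ X, X ∈ G ↔ ((X ∈ F ∧ X ≠ U) ∨ X ∈ up (m-1) {U})) := by
  have hq : 2 ≤ Fintype.card K := Fintype.one_lt_card
  intro j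
  induction j with
  | zero =>
    intro k hk F hF hlow hex
    obtain ⟨G, g1, g2, g3, g4, g5, g6⟩ := push_one (by omega) hF hlow hex
    subst hk
    have e : finrank K V - k - 1 = finrank K V - (k + 0 + 1) := by omega
    rw [e] at g5 g6
    refine ⟨G, g1, g2, g4, g5, ?_⟩
    intro h
    obtain ⟨U, hU, h1, h2⟩ := g6 h
    exact ⟨U, hU, by omega, h2⟩
  | succ j ih =>
    intro k hk F hF hlow hex
    obtain ⟨G, g1, g2, g3, g4, g5, g6⟩ := push_one (by omega) hF hlow hex
    obtain ⟨H, h1, h2, h3, h4, h5⟩ := ih (k+1) (by omega) G g1 g2 g3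
    have : 0 < Fintype.card K * gbinom (Fintype.card K) (finrank K V - k - 1) 1 :=
      Nat.mul_pos (by omega) (gb_one_pos (by omega))
    refine ⟨H, h1, h2, ?_, by omega, by omega⟩
    intro X hX
    rcases h3 X hX with h | h
    · rcases g4 X h with h | h
      · exact Or.inl h
      · exact Or.inr (by omega)
    · exact Or.inr h

theorem push_low {m : ℕ} (hm : 2 * m ≤ finrank K V) {F : Finset (Submodule K V)} (hF : AC F)
    (hex : ∃ X ∈ F, finrank K X < m) :
    ∃ G : Finset (Submodule K V), AC G ∧ (∀ X ∈ G, m ≤ finrank K X) ∧ (∀ X ∈ G, X ∈ F ∨ finrank K X ≤ m) ∧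
      F.card + Fintype.card K * gbinom (Fintype.card K) (finrank K V - m) 1 ≤ G.card ∧
      (G.card = F.card + Fintype.card K * gbinom (Fintype.card K) (finrank K V - m) 1 →
        ∃ U ∈ F, finrank K U + 1 = m ∧ ∀ X, X ∈ G ↔ ((X ∈ F ∧ X ≠ U) ∨ X ∈ up (m-1) {U})) := by
  obtain ⟨X, hX, hXm⟩ := hex
  obtain ⟨Y, hY, hmin⟩ := Finset.exists_min_image F (fun X : Submodule K V => finrank K X) ⟨X, hX⟩
  have := hmin X hX
  exact push_all hm (m - 1 - finrank K Y) (finrank K Y) (by omega) F hF hmin ⟨Y, hY, rfl⟩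

theorem mid_bound (hn : 1 ≤ finrank K V) {F : Finset (Submodule K V)} (hF : AC F)
    (h1 : ∀ X ∈ F, finrank K V / 2 ≤ finrank K X)
    (h2 : ∀ X ∈ F, finrank K X ≤ finrank K V - finrank K V / 2) :
    F.card ≤ gbinom (Fintype.card K) (finrank K V) (finrank K V / 2) := by
  classical
  have hq : 2 ≤ Fintype.card K := Fintype.one_lt_card
  obtain ⟨m, hm⟩ : ∃ m, m = finrank K V / 2 := ⟨_, rfl⟩
  rw [← hm] at h1 h2 ⊢
  have hl := card_lev (K := K) (V := V) (k := m) (by omega)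
  rw [← hl]
  by_cases hev : finrank K V = 2 * m
  · apply Finset.card_le_card
    intro X hX
    have := h1 X hX
    have := h2 X hX
    rw [mem_lev]; omega
  have hodd : finrank K V = 2 * m + 1 := by omega
  have hl' := card_lev (K := K) (V := V) (k := m+1) (by omega)
  have hr := gb_ratio hq (n := 2*m+1) (k := m) (by omega)
  have e1 : 2 * m + 1 - m = m + 1 := by omega
  rw [e1] at hr
  have hN := Nat.eq_of_mul_eq_mul_right (gb_one_pos (by omega : 0 < m+1)) hr
  set A := F.filter (fun X : Submodule K V => finrank K X = m) with hAdef
  have hA : A ⊆ lev K V m := by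
    intro X hX; rw [mem_lev]; exact (Finset.mem_filter.1 hX).2
  have hAF : A ⊆ F := Finset.filter_subset _ _
  have hnm := nm (by omega) hA
  rw [hl', hl, hodd, hN] at hnm
  have hNpos : 0 < gbinom (Fintype.card K) (2*m+1) m := gb_pos hq (by omega)
  have hau := Nat.le_of_mul_le_mul_right hnm hNpos
  have hdisj : Disjoint (F \ A) (up m A) := by
    rw [Finset.disjoint_left]
    intro Z hZ hZ'
    rw [mem_up] at hZ'
    obtain ⟨_, S, hS, hSZ⟩ := hZ'
    rw [Finset.mem_sdiff] at hZ
    have := hF S (hAF hS) Z hZ.1 hSZ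
    rw [this] at hS; exact hZ.2 hS
  have hsub : (F \ A) ∪ up m A ⊆ lev K V (m+1) := by
    intro X hX
    rw [Finset.mem_union] at hX
    rcases hX with hX | hX
    · rw [Finset.mem_sdiff, hAdef, Finset.mem_filter] at hX
      have := h1 X hX.1
      have := h2 X hX.1
      have : finrank K X ≠ m := fun h => hX.2 ⟨hX.1, h⟩
      rw [mem_lev]; omega
    · exact up_sub A hX
  have := Finset.card_le_card hsub
  rw [Finset.card_union_of_disjoint hdisj, hl', hodd, hN] at this
  have := Finset.card_sdiff_add_card_eq_card hAF
  rw [hl, hodd]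
  omega

theorem exists_dual : ∃ e : Submodule K V ≃ Submodule K (Dual K V),
    (∀ X Y, e X ≤ e Y ↔ Y ≤ X) ∧ ∀ X : Submodule K V, finrank K X + finrank K (e X) = finrank K V := by
  refine ⟨(Subspace.orderIsoFiniteDimensional (K := K) (V := V)).toEquiv.trans OrderDual.ofDual, ?_, ?_⟩
  · intro X Y
    exact (Subspace.orderIsoFiniteDimensional (K := K) (V := V)).le_iff_le (x := Y) (y := X)
  · intro X
    exact Subspace.finrank_add_finrank_dualAnnihilator_eq X

end

section
variable {K V V' : Type*} [Field K] [Fintype K] [AddCommGroup V] [Module K V] [FiniteDimensional K V]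
  [Fintype V] [Fintype (Submodule K V)] [AddCommGroup V'] [Module K V'] [FiniteDimensional K V']
  [Fintype V'] [Fintype (Submodule K V')]

theorem AC_map {e : Submodule K V ≃ Submodule K V'} (he : ∀ X Y, e X ≤ e Y ↔ Y ≤ X)
    {F : Finset (Submodule K V)} (hF : AC F) : AC (F.map e.toEmbedding) := by
  intro A hA B hB hAB
  rw [Finset.mem_map] at hA hB
  obtain ⟨X, hX, rfl⟩ := hA
  obtain ⟨Y, hY, rfl⟩ := hB
  rw [hF Y hY X hX ((he X Y).1 hAB)]

theorem sperner0 {e : Submodule K V ≃ Submodule K V'} (he : ∀ X Y, e X ≤ e Y ↔ Y ≤ X)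
    (hd : ∀ X : Submodule K V, finrank K X + finrank K (e X) = finrank K V) (hVV : finrank K V' = finrank K V)
    (hn : 1 ≤ finrank K V) {F : Finset (Submodule K V)} (hF : AC F) 
    (h1 : ∀ X ∈ F, finrank K V / 2 ≤ finrank K X) :
    F.card ≤ gbinom (Fintype.card K) (finrank K V) (finrank K V / 2) ∧ 
    (F.card = gbinom (Fintype.card K) (finrank K V) (finrank K V / 2) →
      ∀ X ∈ F, finrank K X ≤ finrank K V - finrank K V / 2) := by
  by_cases hh : ∀ X ∈ F, finrank K X ≤ finrank K V - finrank K V / 2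
  · exact ⟨mid_bound hn hF h1 hh, fun _ => hh⟩
  · push Not at hh
    obtain ⟨X, hX, hXh⟩ := hh
    obtain ⟨G, g1, g2, g3, g4, _⟩ := push_low (V := V') (m := finrank K V / 2) (by omega) (AC_map he hF)
      ⟨e X, Finset.mem_map_of_mem _ hX, by have := hd X; omega⟩
    have := mid_bound (V := V') (by omega) g1 (by rw [hVV]; exact g2) (by
      rw [hVV]
      intro Y hY
      rcases g3 Y hY with h | h
      · rw [Finset.mem_map] at h
        obtain ⟨Z, hZ, rfl⟩ := h
        have := hd Z
        have := h1 Z hZ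
        simp only [Equiv.toEmbedding_apply]
        omega
      · omega)
    rw [hVV] at this g4
    rw [Finset.card_map] at g4
    have hq : 2 ≤ Fintype.card K := Fintype.one_lt_card
    have : 0 < Fintype.card K * gbinom (Fintype.card K) (finrank K V - finrank K V / 2) 1 :=
      Nat.mul_pos (by omega) (gb_one_pos (by omega))
    omega

/-- first extremal form -/
def Form1 (F : Finset (Submodule K V)) : Prop :=
  ∃ U : Submodule K V, finrank K U = (finrank K V + 1) / 2 - 1 ∧
    ∀ X, X ∈ F ↔ (finrank K X = (finrank K V + 1) / 2 ∧ ¬ U ≤ X) ∨ X = U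

theorem low_main {e : Submodule K V ≃ Submodule K V'} (he : ∀ X Y, e X ≤ e Y ↔ Y ≤ X)
    (hd : ∀ X : Submodule K V, finrank K X + finrank K (e X) = finrank K V) (hVV : finrank K V' = finrank K V)
    (hn : 1 < finrank K V) {F : Finset (Submodule K V)} (hF : AC F) 
    (hex : ∃ X ∈ F, finrank K X < finrank K V / 2) :
    F.card + Fintype.card K * gbinom (Fintype.card K) (finrank K V / 2) 1 
      ≤ gbinom (Fintype.card K) (finrank K V) (finrank K V / 2) ∧
    (F.card + Fintype.card K * gbinom (Fintype.card K) (finrank K V / 2) 1 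
      = gbinom (Fintype.card K) (finrank K V) (finrank K V / 2) → Form1 F) := by
  have hq : 2 ≤ Fintype.card K := Fintype.one_lt_card
  obtain ⟨G, g1, g2, g3, g4, g5⟩ := push_low (m := finrank K V / 2) (by omega) hF hex
  obtain ⟨s1, s2⟩ := sperner0 he hd hVV (by omega) g1 g2
  obtain ⟨m, hm⟩ : ∃ m, m = finrank K V / 2 := ⟨_, rfl⟩
  unfold Form1
  rw [← hm] at g2 g3 g4 g5 s1 s2 ⊢
  by_cases hev : finrank K V = 2 * m
  · have e1 : finrank K V - m = m := by omega
    rw [e1] at g4 g5 s2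
    refine ⟨by omega, fun heq => ?_⟩
    obtain ⟨U, hU, hUm, hG⟩ := g5 (by omega)
    have hl := card_lev (K := K) (V := V) (k := m) (by omega)
    have hGl : G = lev K V m := by
      apply Finset.eq_of_subset_of_card_le
      · intro X hX
        have := g2 X hX
        have := s2 (by omega) X hX
        rw [mem_lev]; omega
      · omega
    refine ⟨U, by omega, ?_⟩
    intro X
    have e2 : (finrank K V + 1) / 2 = m := by omega
    rw [e2]
    rw [hGl] at hG
    have hGX := hG X
    rw [mem_lev] at hGX
    constructor
    · intro hX
      by_cases hXU : X = U
      · exact Or.inr hXU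
      · left
        refine ⟨hGX.2 (Or.inl ⟨hX, hXU⟩), fun hle => hXU (hF U hU X hX hle).symm⟩
    · rintro (⟨h1, h2⟩ | rfl)
      · rcases hGX.1 h1 with h | h
        · exact h.1
        · rw [mem_up] at h
          obtain ⟨_, T, hT, hTX⟩ := h
          rw [Finset.mem_singleton] at hT
          rw [hT] at hTX
          exact (h2 hTX).elim
      · exact hU
  · have e1 : finrank K V - m = m + 1 := by omega
    rw [e1, gb_one_succ] at g4
    have hpos : 0 < gbinom (Fintype.card K) m 1 := gb_one_pos (by omega)
    have : Fintype.card K * gbinom (Fintype.card K) m 1 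
      < Fintype.card K * (1 + Fintype.card K * gbinom (Fintype.card K) m 1) := by
      apply Nat.mul_lt_mul_of_pos_left _ (by omega)
      nlinarith
    omega

theorem mid_main (hn : 1 < finrank K V) {m : ℕ} (hV : finrank K V = 2 * m + 1)
    {F : Finset (Submodule K V)} (hF : AC F) 
    (h1 : ∀ X ∈ F, finrank K X = m ∨ finrank K X = m + 1)
    (hex : ∃ X ∈ F, finrank K X = m)
    (hhalf : 2 * (F.filter (fun X : Submodule K V => finrank K X = m)).card ≤ F.card) :
    F.card + Fintype.card K * gbinom (Fintype.card K) (finrank K V / 2) 1 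
      ≤ gbinom (Fintype.card K) (finrank K V) (finrank K V / 2) ∧
    (F.card + Fintype.card K * gbinom (Fintype.card K) (finrank K V / 2) 1 
      = gbinom (Fintype.card K) (finrank K V) (finrank K V / 2) → Form1 F) := by
  classical
  have hq : 2 ≤ Fintype.card K := Fintype.one_lt_card
  have hsp := mid_bound (by omega) hF (by intro X hX; have := h1 X hX; omega)
    (by intro X hX; have := h1 X hX; omega)
  have e0 : finrank K V / 2 = m := by omega
  have e2 : (finrank K V + 1) / 2 = m + 1 := by omega
  unfold Form1
  rw [e2]
  rw [e0] at hsp ⊢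
  have hl' := card_lev (K := K) (V := V) (k := m+1) (by omega)
  have hr := gb_ratio hq (n := 2*m+1) (k := m) (by omega)
  have e1 : 2 * m + 1 - m = m + 1 := by omega
  rw [e1] at hr
  have hN := Nat.eq_of_mul_eq_mul_right (gb_one_pos (by omega : 0 < m+1)) hr
  set A := F.filter (fun X : Submodule K V => finrank K X = m) with hAdef
  have hA : A ⊆ lev K V m := by
    intro X hX; rw [mem_lev]; exact (Finset.mem_filter.1 hX).2
  have hAF : A ⊆ F := Finset.filter_subset _ _
  have hAne : A.Nonempty := by
    obtain ⟨X, hX, h⟩ := hex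
    exact ⟨X, Finset.mem_filter.2 ⟨hX, h⟩⟩
  obtain ⟨p1, p2⟩ := mid_level (by omega) hV hA hAne (by rw [← hV]; omega)
  have hdisj : Disjoint (F \ A) (up m A) := by
    rw [Finset.disjoint_left]
    intro Z hZ hZ'
    rw [mem_up] at hZ'
    obtain ⟨_, S, hS, hSZ⟩ := hZ'
    rw [Finset.mem_sdiff] at hZ
    have := hF S (hAF hS) Z hZ.1 hSZ
    rw [this] at hS; exact hZ.2 hS
  have hsub : (F \ A) ∪ up m A ⊆ lev K V (m+1) := by
    intro X hX
    rw [Finset.mem_union] at hX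
    rcases hX with hX | hX
    · rw [Finset.mem_sdiff, hAdef, Finset.mem_filter] at hX
      have := h1 X hX.1
      have : finrank K X ≠ m := fun h => hX.2 ⟨hX.1, h⟩
      rw [mem_lev]; omega
    · exact up_sub A hX
  have h3 := Finset.card_le_card hsub
  have h4 := Finset.card_sdiff_add_card_eq_card hAF
  have h5 := Finset.card_union_of_disjoint hdisj
  rw [hV, hN] at hl'
  rw [hV]
  refine ⟨by omega, fun heq => ?_⟩
  obtain ⟨U, hU⟩ := Finset.card_eq_one.1 (p2 (by omega))
  have hUA : U ∈ A := by rw [hU]; simp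
  have hUm := mem_lev.1 (hA hUA)
  have hall := Finset.eq_of_subset_of_card_le hsub (by omega)
  refine ⟨U, by omega, ?_⟩
  intro X
  constructor
  · intro hX
    by_cases hXU : X = U
    · exact Or.inr hXU
    · left
      have hXA : X ∉ A := by rw [hU]; simpa using hXU
      refine ⟨?_, fun hle => hXU (hF U (hAF hUA) X hX hle).symm⟩
      have := hsub (Finset.mem_union_left _ (Finset.mem_sdiff.2 ⟨hX, hXA⟩))
      exact mem_lev.1 this
  · rintro (⟨h1, h2⟩ | rfl)
    · have : X ∈ (F \ A) ∪ up m A := by rw [hall]; exact mem_lev.2 h1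
      rw [Finset.mem_union] at this
      rcases this with h | h
      · exact (Finset.mem_sdiff.1 h).1
      · rw [mem_up, hU] at h
        obtain ⟨_, T, hT, hTX⟩ := h
        rw [Finset.mem_singleton] at hT
        rw [hT] at hTX
        exact (h2 hTX).elim
    · exact hAF hUA

theorem form1_card (hn : 1 < finrank K V) {F : Finset (Submodule K V)} (h : Form1 F) :
    F.card + Fintype.card K * gbinom (Fintype.card K) (finrank K V / 2) 1 
      = gbinom (Fintype.card K) (finrank K V) (finrank K V / 2) := by
  classical
  have hq : 2 ≤ Fintype.card K := Fintype.one_lt_card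
  obtain ⟨U, hU, hF⟩ := h
  obtain ⟨k, hk⟩ : ∃ k, k = (finrank K V + 1) / 2 - 1 := ⟨_, rfl⟩
  have hk' : (finrank K V + 1) / 2 = k + 1 := by omega
  rw [← hk] at hU
  rw [hk'] at hF
  have hl := card_lev (K := K) (V := V) (k := k+1) (by omega)
  have hup := up_deg hU
  have hsub := up_sub (k := k) {U}
  have hFe : F = insert U (lev K V (k+1) \ up k {U}) := by
    ext X
    rw [hF X, Finset.mem_insert, Finset.mem_sdiff, mem_lev, mem_up]
    simp only [Finset.mem_singleton, exists_eq_left]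
    tauto
  have hUn : U ∉ (lev K V (k+1) \ up k {U}) := by
    rw [Finset.mem_sdiff, mem_lev]; omega
  have hc := Finset.card_sdiff_add_card_eq_card hsub
  rw [hFe, Finset.card_insert_of_notMem hUn]
  have e3 : finrank K V - k = finrank K V / 2 + 1 := by omega
  rw [e3, gb_one_succ] at hup
  have hsym : gbinom (Fintype.card K) (finrank K V) (k+1) =
      gbinom (Fintype.card K) (finrank K V) (finrank K V / 2) := by
    by_cases hev : finrank K V / 2 = k + 1
    · rw [hev]
    · have e4 : finrank K V / 2 = k := by omega
      have hr := gb_ratio hq (n := finrank K V) (k := k) (by omega)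
      have e5 : finrank K V - k = k + 1 := by omega
      rw [e5] at hr
      rw [e4]
      exact Nat.eq_of_mul_eq_mul_right (gb_one_pos (by omega : 0 < k+1)) hr
  omega

theorem form2_iff {e : Submodule K V ≃ Submodule K V'} (he : ∀ X Y, e X ≤ e Y ↔ Y ≤ X)
    (hd : ∀ X : Submodule K V, finrank K X + finrank K (e X) = finrank K V) (hVV : finrank K V' = finrank K V)
    (hn : 1 < finrank K V) {F : Finset (Submodule K V)} :
    Form1 (F.map e.toEmbedding) ↔ ∃ W : Submodule K V, finrank K W = finrank K V / 2 + 1 ∧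
    ∀ X, X ∈ F ↔ (finrank K X = finrank K V / 2 ∧ ¬ X ≤ W) ∨ X = W := by
  unfold Form1
  rw [hVV]
  constructor
  · rintro ⟨U, hU, hF⟩
    refine ⟨e.symm U, ?_, ?_⟩
    · have := hd (e.symm U)
      rw [e.apply_symm_apply] at this
      omega
    · intro X
      have h1 := hF (e X)
      have h2 := hd X
      have h3 := he (e.symm U) X
      rw [e.apply_symm_apply] at h3
      rw [h3, Finset.mem_map_equiv, e.symm_apply_apply, ← Equiv.eq_symm_apply] at h1
      rw [h1]
      have : finrank K (e X) = (finrank K V + 1)/2 ↔ finrank K X = finrank K V / 2 := by omega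
      rw [this]
  · rintro ⟨W, hW, hF⟩
    refine ⟨e W, ?_, ?_⟩
    · have := hd W; omega
    · intro Y
      obtain ⟨X, rfl⟩ := e.surjective Y
      have h2 := hd X
      have : finrank K (e X) = (finrank K V + 1)/2 ↔ finrank K X = finrank K V / 2 := by omega
      rw [Finset.mem_map_equiv, e.symm_apply_apply, hF, he, this, e.apply_eq_iff_eq]

end

theorem stmt_15 (q n : ℕ) (K : Type*) [Field K] [Fintype K] (hK : Fintype.card K = q)
    (V : Type*) [AddCommGroup V] [Module K V] [FiniteDimensional K V]
    (hV : finrank K V = n) (hn : 1 < n)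
    (F : Set (Submodule K V))
    (hF : ∀ A ∈ F, ∀ B ∈ F, A ≠ B → ¬ A ≤ B)
    (h1 : ¬ F ⊆ {A : Submodule K V | finrank K A = n / 2})
    (h2 : ¬ F ⊆ {A : Submodule K V | finrank K A = (n + 1) / 2}) :
    (F.ncard : ℤ) ≤ (gbinom q n (n / 2) : ℤ) - (q : ℤ) * (gbinom q (n / 2) 1 : ℤ)
    ∧ ((F.ncard : ℤ) = (gbinom q n (n / 2) : ℤ) - (q : ℤ) * (gbinom q (n / 2) 1 : ℤ)
        ↔ (∃ U : Submodule K V, finrank K U = (n + 1) / 2 - 1 ∧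
              F = {A : Submodule K V | finrank K A = (n + 1) / 2 ∧ ¬ U ≤ A} ∪ {U})
          ∨ (∃ W : Submodule K V, finrank K W = n / 2 + 1 ∧
              F = {A : Submodule K V | finrank K A = n / 2 ∧ ¬ A ≤ W} ∪ {W})) := by
  classical
  subst hK
  subst hV
  have i1 : Finite V := Module.finite_of_finite K
  have i2 : Fintype V := Fintype.ofFinite V
  have i3 : Fintype (Submodule K V) := Fintype.ofFinite _
  have i4 : Finite (Dual K V) := Module.finite_of_finite K
  have i5 : Fintype (Dual K V) := Fintype.ofFinite _
  have i6 : Fintype (Submodule K (Dual K V)) := Fintype.ofFinite _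
  obtain ⟨e, he, hd⟩ := exists_dual (K := K) (V := V)
  have hVV : finrank K (Dual K V) = finrank K V := Subspace.dual_finrank_eq
  -- the dual of the dual
  obtain ⟨e', he', hd'⟩ : ∃ e' : Submodule K (Dual K V) ≃ Submodule K V,
      (∀ X Y, e' X ≤ e' Y ↔ Y ≤ X) ∧ ∀ X : Submodule K (Dual K V), finrank K X + finrank K (e' X) = finrank K (Dual K V) := by
    refine ⟨e.symm, ?_, ?_⟩
    · intro X Y
      have := he (e.symm Y) (e.symm X)
      simp only [e.apply_symm_apply] at this
      exact this.symm
    · intro X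
      have := hd (e.symm X)
      rw [e.apply_symm_apply] at this
      omega
  obtain ⟨G, rfl⟩ : ∃ G : Finset (Submodule K V), F = G := ⟨F.toFinite.toFinset, by simp⟩
  have hG : AC G := by
    intro A hA B hB hAB
    by_contra hne
    exact hF A hA B hB hne hAB
  rw [Set.ncard_coe_finset]
  have f1 : (∃ U : Submodule K V, finrank K U = (finrank K V + 1) / 2 - 1 ∧
              (G : Set (Submodule K V)) = {A : Submodule K V | finrank K A = (finrank K V + 1) / 2 ∧ ¬ U ≤ A} ∪ {U})
      ↔ Form1 G := by
    simp only [Form1, Set.ext_iff, Finset.mem_coe, Set.mem_union, Set.mem_ofPred_eq, Set.mem_singleton_iff]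
  have f2 : (∃ W : Submodule K V, finrank K W = finrank K V / 2 + 1 ∧
              (G : Set (Submodule K V)) = {A : Submodule K V | finrank K A = finrank K V / 2 ∧ ¬ A ≤ W} ∪ {W})
      ↔ Form1 (G.map e.toEmbedding) := by
    rw [form2_iff he hd hVV hn]
    simp only [Set.ext_iff, Finset.mem_coe, Set.mem_union, Set.mem_ofPred_eq, Set.mem_singleton_iff]
  rw [f1, f2]
  have hG' := AC_map he hG
  suffices hmain : G.card + Fintype.card K * gbinom (Fintype.card K) (finrank K V / 2) 1 
      ≤ gbinom (Fintype.card K) (finrank K V) (finrank K V / 2) ∧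
    (G.card + Fintype.card K * gbinom (Fintype.card K) (finrank K V / 2) 1 
      = gbinom (Fintype.card K) (finrank K V) (finrank K V / 2) →
      Form1 G ∨ Form1 (G.map e.toEmbedding)) by
    obtain ⟨m1, m2⟩ := hmain
    zify at m1 m2
    refine ⟨by linarith, fun h => m2 (by linarith), ?_⟩
    rintro (h | h)
    · have := form1_card hn h
      zify at this; linarith
    · have := form1_card (by omega) h
      rw [Finset.card_map, hVV] at this
      zify at this; linarith
  by_cases c1 : ∃ X ∈ G, finrank K X < finrank K V / 2
  · obtain ⟨m1, m2⟩ := low_main he hd hVV hn hG c1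
    exact ⟨m1, fun h => Or.inl (m2 h)⟩
  by_cases c2 : ∃ X ∈ G, finrank K V - finrank K V / 2 < finrank K X
  · obtain ⟨X, hX, hXc⟩ := c2
    obtain ⟨m1, m2⟩ := low_main he' hd' hVV.symm (by omega) hG' 
      ⟨e X, Finset.mem_map_of_mem _ hX, by have := hd X; omega⟩
    rw [Finset.card_map, hVV] at m1 m2
    exact ⟨m1, fun h => Or.inr (m2 h)⟩
  push Not at c1 c2
  obtain ⟨m, hm⟩ : ∃ m, m = finrank K V / 2 := ⟨_, rfl⟩
  have hodd : finrank K V = 2 * m + 1 := by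
    by_contra hne
    apply h1
    intro X hX
    have := c1 X hX
    have := c2 X hX
    simp only [Set.mem_ofPred_eq]; omega
  have hlev : ∀ X ∈ G, finrank K X = m ∨ finrank K X = m + 1 := by
    intro X hX
    have := c1 X hX
    have := c2 X hX
    omega
  have hA : ∃ X ∈ G, finrank K X = m := by
    by_contra hcon
    push Not at hcon
    apply h2
    intro X hX
    have := hlev X hX
    have := hcon X hX
    simp only [Set.mem_ofPred_eq]; omega
  have hB : ∃ X ∈ G, finrank K X = m + 1 := by
    by_contra hcon
    push Not at hcon
    apply h1
    intro X hX
    have := hlev X hX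
    have := hcon X hX
    simp only [Set.mem_ofPred_eq]; omega
  by_cases hhalf : 2 * (G.filter (fun X : Submodule K V => finrank K X = m)).card ≤ G.card
  · obtain ⟨m1, m2⟩ := mid_main hn hodd hG hlev hA hhalf
    exact ⟨m1, fun h => Or.inl (m2 h)⟩
  · obtain ⟨X, hX, hXc⟩ := hB
    have hfe : (G.map e.toEmbedding).filter (fun X : Submodule K (Dual K V) => finrank K X = m) =
        (G.filter (fun X : Submodule K V => ¬ finrank K X = m)).map e.toEmbedding := by
      rw [Finset.filter_map]
      congr 1
      apply Finset.filter_congr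
      intro Y hY
      have := hd Y
      have := hlev Y hY
      simp only [Function.comp, Equiv.toEmbedding_apply]
      omega
    have hsum := Finset.card_filter_add_card_filter_not (s := G) (fun X : Submodule K V => finrank K X = m)
    obtain ⟨m1, m2⟩ := mid_main (V := Dual K V) (m := m) (by omega) (by omega) hG' 
      (by
        intro Y hY
        rw [Finset.mem_map] at hY
        obtain ⟨Z, hZ, rfl⟩ := hY
        have := hd Z
        have := hlev Z hZ
        simp only [Equiv.toEmbedding_apply]
        omega)
      ⟨e X, Finset.mem_map_of_mem _ hX, by have := hd X; omega⟩
      (by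
        rw [hfe, Finset.card_map, Finset.card_map]
        omega)
    rw [Finset.card_map, hVV] at m1 m2
    exact ⟨m1, fun h => Or.inr (m2 h)⟩
end

section
/- Let V be an n-dimensional vector space over F_q and F ⊆ L(V) an s-union antichain with 2 ≤ s < n. Then |F| ≤ [n choose ⌊s/2⌋]_q. -/
open Module Set

open Classical in
theorem aux_down {K V : Type*} [Field K] [Fintype K] [AddCommGroup V] [Module K V]
    [FiniteDimensional K V] (k : ℕ) (G : Finset (Submodule K V))
    (hG : ∀ A ∈ G, finrank K A = k + 1) (x : Submodule K V → ℚ)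
    (hx : ∀ U : Submodule K V, finrank K U = k → ∑ A ∈ G with U ≤ A, x A = 0) :
    ∀ (j : ℕ) (U : Submodule K V), finrank K U + j = k → ∑ A ∈ G with U ≤ A, x A = 0 := by
  have : Finite V := Module.finite_of_finite K
  have : Fintype V := Fintype.ofFinite V
  intro j
  induction j with
  | zero => intro U hU; exact hx U hU
  | succ j ih =>
    intro U hU
    have h1 : ∑ v : V with v ∉ U, ∑ A ∈ G with U ⊔ Submodule.span K {v} ≤ A, x A = 0 := by
      apply Finset.sum_eq_zero
      intro v hv
      apply ih
      have hv' : v ∉ U := by simpa using hv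
      have := Submodule.finrank_sup_span_singleton hv'
      omega
    have h2 : ∑ v : V with v ∉ U, ∑ A ∈ G with U ⊔ Submodule.span K {v} ≤ A, x A
        = ∑ A ∈ G with U ≤ A, ((Fintype.card K : ℚ) ^ (k + 1) - (Fintype.card K : ℚ) ^ (finrank K U)) * x A := by
      simp_rw [Finset.sum_filter]
      rw [← Finset.sum_filter, Finset.sum_comm]
      apply Finset.sum_congr rfl
      intro A hA
      split_ifs with hUA
      · simp only [sup_le_iff, hUA, true_and, Submodule.span_singleton_le_iff_mem]
        rw [← Finset.sum_filter, Finset.sum_const, nsmul_eq_mul]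
        congr 1
        have e : Finset.filter (fun v => v ∈ A) (Finset.univ.filter (fun v => v ∉ U))
            = (Finset.univ.filter (fun v => v ∈ A)) \ (Finset.univ.filter (fun v => v ∈ U)) := by
          ext v; simp [and_comm]
        rw [e, Finset.cast_card_sdiff]
        · rw [← Fintype.card_subtype, ← Fintype.card_subtype]
          have c1 := Module.card_eq_pow_finrank (K := K) (V := A)
          have c2 := Module.card_eq_pow_finrank (K := K) (V := U)
          rw [hG A hA] at c1
          have d1 : Fintype.card {v // v ∈ A} = Fintype.card K ^ (k+1) := by
            rw [← c1]
          have d2 : Fintype.card {v // v ∈ U} = Fintype.card K ^ (finrank K U) := by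
            rw [← c2]
          rw [d1, d2]; push_cast; rfl
        · intro v hv
          simp at hv ⊢
          exact hUA hv
      · apply Finset.sum_eq_zero
        intro v _
        rw [if_neg]
        intro h
        exact hUA (le_sup_left.trans h)
    rw [h1, ← Finset.mul_sum] at h2
    rcases mul_eq_zero.mp h2.symm with h | h
    · exfalso
      have hq : (1 : ℚ) < Fintype.card K := by exact_mod_cast Fintype.one_lt_card
      have := pow_lt_pow_right₀ hq (show finrank K U < k + 1 by omega)
      linarith
    · exact h

open Classical in
theorem aux_ker {K V : Type*} [Field K] [Fintype K] [AddCommGroup V] [Module K V]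
    [FiniteDimensional K V] (k : ℕ) (G : Finset (Submodule K V))
    (hG : ∀ A ∈ G, finrank K A = k + 1)
    (hI : ∀ A ∈ G, ∀ B ∈ G, A ⊓ B ≠ ⊥) (x : Submodule K V → ℚ)
    (hx : ∀ U : Submodule K V, finrank K U = k → ∑ A ∈ G with U ≤ A, x A = 0) :
    ∀ B ∈ G, x B = 0 := by
  have : Finite V := Module.finite_of_finite K
  have : Fintype V := Fintype.ofFinite V
  have hd := aux_down k G hG x hx
  intro B hB
  have hq : (1 : ℚ) < Fintype.card K := by exact_mod_cast Fintype.one_lt_card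
  set q : ℚ := (Fintype.card K : ℚ) with hqdef
  have hcard : ∀ A : Submodule K V, ((Finset.univ.filter (fun v => v ∈ A)).card : ℚ)
      = q ^ finrank K A := by
    intro A
    rw [← Fintype.card_subtype]
    have c1 := Module.card_eq_pow_finrank (K := K) (V := A)
    have d1 : Fintype.card {v // v ∈ A} = Fintype.card K ^ (finrank K A) := by
      rw [← c1]
    rw [d1]; push_cast; rfl
  have key : ∀ (m : ℕ) (U : Submodule K V), finrank K U + m ≤ k →
      ∑ A ∈ G with U ≤ A, x A * ∏ l ∈ Finset.range m, (q ^ finrank K ↥(A ⊓ B) - q ^ (l+1)) = 0 := by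
    intro m
    induction m with
    | zero =>
      intro U hU
      simpa using hd (k - finrank K U) U (by omega)
    | succ m ih =>
      intro U hU
      have h1 : ∑ v : V with v ∈ B, ∑ A ∈ G with U ⊔ Submodule.span K {v} ≤ A,
          x A * ∏ l ∈ Finset.range m, (q ^ finrank K ↥(A ⊓ B) - q ^ (l+1)) = 0 := by
        apply Finset.sum_eq_zero
        intro v hv
        apply ih
        have h3 := Submodule.finrank_add_le_finrank_add_finrank U (Submodule.span K {v})
        have h4 : finrank K (Submodule.span K {v}) ≤ 1 := by
          have := finrank_span_le_card (R := K) ({v} : Set V)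
          simpa using this
        omega
      have h2 : ∑ v : V with v ∈ B, ∑ A ∈ G with U ⊔ Submodule.span K {v} ≤ A,
          x A * ∏ l ∈ Finset.range m, (q ^ finrank K ↥(A ⊓ B) - q ^ (l+1)) 
          = ∑ A ∈ G with U ≤ A, q ^ finrank K ↥(A ⊓ B) * (x A * ∏ l ∈ Finset.range m, (q ^ finrank K ↥(A ⊓ B) - q ^ (l+1))) := by
        simp_rw [Finset.sum_filter]
        rw [← Finset.sum_filter, Finset.sum_comm]
        apply Finset.sum_congr rfl
        intro A hA
        split_ifs with hUA
        · simp only [sup_le_iff, hUA, true_and, Submodule.span_singleton_le_iff_mem]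
          rw [← Finset.sum_filter, Finset.sum_const, nsmul_eq_mul, ← hcard]
          congr 3
          ext v; simp [and_comm]
        · apply Finset.sum_eq_zero
          intro v _
          rw [if_neg]
          intro h
          exact hUA (le_sup_left.trans h)
      have h3 := ih U (by omega)
      rw [h1] at h2
      have h4 : ∀ A, x A * ∏ l ∈ Finset.range (m+1), (q ^ finrank K ↥(A ⊓ B) - q ^ (l+1))
          = q ^ finrank K ↥(A ⊓ B) * (x A * ∏ l ∈ Finset.range m, (q ^ finrank K ↥(A ⊓ B) - q ^ (l+1)))
            - q ^ (m+1) * (x A * ∏ l ∈ Finset.range m, (q ^ finrank K ↥(A ⊓ B) - q ^ (l+1))) := by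
        intro A; rw [Finset.prod_range_succ]; ring
      simp_rw [h4]
      rw [Finset.sum_sub_distrib, ← h2, ← Finset.mul_sum, h3]
      simp
  have h := key k ⊥ (by simp)
  rw [Finset.sum_eq_single B] at h
  · rcases mul_eq_zero.mp h with h | h
    · exact h
    · exfalso
      obtain ⟨l, hl, h⟩ := Finset.prod_eq_zero_iff.mp h
      rw [inf_idem, hG B hB] at h
      have := pow_lt_pow_right₀ hq (show l + 1 < k + 1 by simpa using hl)
      linarith
  · intro A hA hAB
    have hA' : A ∈ G := (Finset.mem_filter.mp hA).1
    have p1 : 0 < finrank K ↥(A ⊓ B) := by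
      rw [Nat.pos_iff_ne_zero, Ne, Submodule.finrank_eq_zero]
      exact hI A hA' B hB
    have p2 : finrank K ↥(A ⊓ B) < k + 1 := by
      by_contra hcon
      have e1 : A ⊓ B = A := Submodule.eq_of_le_of_finrank_le inf_le_left (by rw [hG A hA']; omega)
      have e2 : A ⊓ B = B := Submodule.eq_of_le_of_finrank_le inf_le_right (by rw [hG B hB]; omega)
      exact hAB (e1.symm.trans e2)
    rw [Finset.prod_eq_zero (i := finrank K ↥(A ⊓ B) - 1), mul_zero]
    · simp; omega
    · rw [Nat.sub_add_cancel p1, sub_self]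
  · intro hn
    exact absurd (by simp [hB]) hn

open Classical in
theorem aux_shadow {K V : Type*} [Field K] [Fintype K] [AddCommGroup V] [Module K V]
    [FiniteDimensional K V] (k : ℕ) (G S : Finset (Submodule K V))
    (hG : ∀ A ∈ G, finrank K A = k + 1)
    (hI : ∀ A ∈ G, ∀ B ∈ G, A ⊓ B ≠ ⊥)
    (hS : ∀ A ∈ G, ∀ U : Submodule K V, U ≤ A → finrank K U = k → U ∈ S) :
    G.card ≤ S.card := by
  let M : Matrix S G ℚ := fun U A => if U.1 ≤ A.1 then 1 else 0
  have inj : Function.Injective M.mulVecLin := by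
    rw [← LinearMap.ker_eq_bot, LinearMap.ker_eq_bot']
    intro y hy
    let x : Submodule K V → ℚ := fun A => if h : A ∈ G then y ⟨A, h⟩ else 0
    have hx0 := aux_ker k G hG hI x (by
      intro U hU
      by_cases hUS : U ∈ S
      · have := congrFun hy ⟨U, hUS⟩
        rw [Matrix.mulVecLin_apply] at this
        simp only [Matrix.mulVec, dotProduct, M, Pi.zero_apply] at this
        rw [Finset.sum_filter, ← Finset.sum_coe_sort]
        refine Eq.trans ?_ this
        apply Finset.sum_congr rfl
        intro A _
        simp [x]
      · apply Finset.sum_eq_zero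
        intro A hA
        rw [Finset.mem_filter] at hA
        exact absurd (hS A hA.1 U hA.2 hU) hUS)
    ext A
    have := hx0 A.1 A.2
    simpa [x] using this
  have := LinearMap.finrank_le_finrank_of_injective inj
  simpa using this

open Classical in
theorem aux_push {K V : Type*} [Field K] [Fintype K] [AddCommGroup V] [Module K V]
    [FiniteDimensional K V] (s d : ℕ) (hsd : s ≤ 2 * d + 1) (j : ℕ) :
    ∀ F : Finset (Submodule K V), (∀ A ∈ F, ∀ B ∈ F, finrank K ↥(A ⊔ B) ≤ s) →
    (∀ A ∈ F, ∀ B ∈ F, A ≤ B → A = B) → (∀ A ∈ F, finrank K A ≤ d + j) →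
    ∃ F' : Finset (Submodule K V), (∀ A ∈ F', ∀ B ∈ F', A ≤ B → A = B) ∧
      (∀ A ∈ F', finrank K A ≤ d) ∧ F.card ≤ F'.card ∧
      ((∀ A ∈ F, d ≤ finrank K A) → ∀ A ∈ F', d ≤ finrank K A) := by
  have : Finite V := Module.finite_of_finite K
  have : Fintype V := Fintype.ofFinite V
  have : Fintype (Submodule K V) := Fintype.ofFinite _
  induction j with
  | zero => intro F h1 h2 h3; exact ⟨F, h2, h3, le_rfl, id⟩
  | succ j ih =>
    intro F h1 h2 h3
    let G := F.filter (fun A : Submodule K V => finrank K A = d + j + 1)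
    let H := F.filter (fun A : Submodule K V => ¬ finrank K A = d + j + 1)
    let S : Finset (Submodule K V) := Finset.univ.filter
      (fun U => finrank K U = d + j ∧ ∃ A ∈ F, finrank K A = d + j + 1 ∧ U ≤ A)
    have hGS : G.card ≤ S.card := by
      apply aux_shadow (d + j) G S
      · intro A hA; exact (Finset.mem_filter.mp hA).2
      · intro A hA B hB hb
        obtain ⟨hA1, hA2⟩ := Finset.mem_filter.mp hA
        obtain ⟨hB1, hB2⟩ := Finset.mem_filter.mp hB
        have e := Submodule.finrank_sup_add_finrank_inf_eq A B
        rw [hb, finrank_bot] at e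
        have := h1 A hA1 B hB1
        omega
      · intro A hA U hU hU2
        obtain ⟨hA1, hA2⟩ := Finset.mem_filter.mp hA
        simp only [S, Finset.mem_filter, Finset.mem_univ, true_and]
        exact ⟨hU2, A, hA1, hA2, hU⟩
    have memH : ∀ X, X ∈ H → X ∈ F ∧ finrank K X ≤ d + j := by
      intro X hX
      obtain ⟨a, b⟩ := Finset.mem_filter.mp hX
      have := h3 X a
      exact ⟨a, by omega⟩
    have memS : ∀ X, X ∈ S → finrank K X = d + j ∧ ∃ A ∈ F, finrank K A = d + j + 1 ∧ X ≤ A := by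
      intro X hX; exact (Finset.mem_filter.mp hX).2
    have hdis : Disjoint H S := by
      rw [Finset.disjoint_left]
      intro X hX hX'
      obtain ⟨a, b⟩ := memH X hX
      obtain ⟨c, A, hA, hA2, hA3⟩ := memS X hX'
      have := h2 X a A hA hA3
      subst this
      omega
    have hcard : F.card ≤ (H ∪ S).card := by
      rw [Finset.card_union_of_disjoint hdis]
      have := Finset.card_filter_add_card_filter_not (s := F) (fun A => finrank K A = d + j + 1)
      change G.card + H.card = F.card at this
      omega
    have hup : ∀ X ∈ H ∪ S, ∃ A ∈ F, X ≤ A := by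
      intro X hX
      rcases Finset.mem_union.mp hX with h | h
      · exact ⟨X, (memH X h).1, le_rfl⟩
      · obtain ⟨c, A, hA, hA2, hA3⟩ := memS X h
        exact ⟨A, hA, hA3⟩
    obtain ⟨F', f1, f2, f3, f4⟩ := ih (H ∪ S) (by
      intro A hA B hB
      obtain ⟨A', hA', hA2⟩ := hup A hA
      obtain ⟨B', hB', hB2⟩ := hup B hB
      exact (Submodule.finrank_mono (sup_le_sup hA2 hB2)).trans (h1 A' hA' B' hB')) (by
      intro X hX Y hY hXY
      rcases Finset.mem_union.mp hX with h | h
      · rcases Finset.mem_union.mp hY with h' | h'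
        · exact h2 X (memH X h).1 Y (memH Y h').1 hXY
        · obtain ⟨c, A, hA, hA2, hA3⟩ := memS Y h'
          obtain ⟨a, b⟩ := memH X h
          have := h2 X a A hA (hXY.trans hA3)
          subst this
          omega
      · have e := (memS X h).1
        have e2 : finrank K Y ≤ d + j := by
          rcases Finset.mem_union.mp hY with h' | h'
          · exact (memH Y h').2
          · exact (memS Y h').1.le
        exact Submodule.eq_of_le_of_finrank_le hXY (by omega)) (by
      intro Y hY
      rcases Finset.mem_union.mp hY with h' | h'
      · exact (memH Y h').2
      · exact (memS Y h').1.le)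
    refine ⟨F', f1, f2, hcard.trans f3, ?_⟩
    intro hd
    apply f4
    intro X hX
    rcases Finset.mem_union.mp hX with h | h
    · exact hd X (memH X h).1
    · have := (memS X h).1; omega

theorem aux_gbinom (q : ℕ) (n : ℕ) : ∀ k : ℕ,
    (gbinom q n k : ℤ) * ∏ i ∈ Finset.range k, ((q : ℤ) ^ k - q ^ i)
      = ∏ i ∈ Finset.range k, ((q : ℤ) ^ n - q ^ i) := by
  have P : ∀ n k : ℕ, ∏ i ∈ Finset.range (k+1), ((q : ℤ) ^ (n+1) - q ^ i)
      = (q ^ (n+1) - 1) * q ^ k * ∏ i ∈ Finset.range k, ((q : ℤ) ^ n - q ^ i) := by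
    intro n k
    rw [Finset.prod_range_succ']
    have : ∏ i ∈ Finset.range k, ((q : ℤ) ^ (n+1) - q ^ (i+1))
        = q ^ k * ∏ i ∈ Finset.range k, ((q : ℤ) ^ n - q ^ i) := by
      rw [← Finset.card_range k, ← Finset.prod_const, Finset.card_range, ← Finset.prod_mul_distrib]
      apply Finset.prod_congr rfl
      intro i _; ring
    rw [this]; ring
  induction n with
  | zero =>
    intro k
    cases k with
    | zero => simp [gbinom]
    | succ k => rw [Finset.prod_range_succ' (fun i => ((q : ℤ) ^ 0 - q ^ i))]; simp [gbinom]
  | succ n ih =>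
    intro k
    cases k with
    | zero => simp [gbinom]
    | succ k =>
      have i1 := ih k
      have i2 := ih (k+1)
      rw [Finset.prod_range_succ (fun i => ((q : ℤ) ^ n - q ^ i))] at i2
      have p1 := P k k
      rw [P n k]
      rw [gbinom]
      push_cast
      rw [add_mul, mul_assoc ((q:ℤ)^(k+1)), i2, p1]
      linear_combination ((q:ℤ)^(k+1) - 1) * q^k * i1

open Classical in
theorem aux_count {K V : Type*} [Field K] [Fintype K] [AddCommGroup V] [Module K V]
    [FiniteDimensional K V] (d : ℕ) (hd : d ≤ finrank K V) (F : Finset (Submodule K V))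
    (hF : ∀ A ∈ F, finrank K A = d) :
    F.card ≤ gbinom (Fintype.card K) (finrank K V) d := by
  have : Finite V := Module.finite_of_finite K
  have : Fintype V := Fintype.ofFinite V
  let T := (A : F) × { s : Fin d → A.1 // LinearIndependent K s }
  let φ : T → { s : Fin d → V // LinearIndependent K s } := fun t =>
    ⟨fun i => (t.2.1 i : V), t.2.2.map' t.1.1.subtype (Submodule.ker_subtype _)⟩
  have hspan : ∀ t : T, Submodule.span K (Set.range (φ t).1) = t.1.1 := by
    intro t
    apply Submodule.eq_of_le_of_finrank_le
    · rw [Submodule.span_le]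
      rintro _ ⟨i, rfl⟩
      exact (t.2.1 i).2
    · rw [finrank_span_eq_card (φ t).2, hF _ t.1.2]; simp
  have inj : Function.Injective φ := by
    intro t t' h
    have e : t.1 = t'.1 := by
      apply Subtype.ext
      rw [← hspan t, ← hspan t', h]
    obtain ⟨A, s, hs⟩ := t
    obtain ⟨A', s', hs'⟩ := t'
    simp only at e
    subst e
    congr 1
    apply Subtype.ext
    funext i
    apply Subtype.ext
    exact congrFun (congrArg Subtype.val h) i
  have hc := Nat.card_le_card_of_injective φ inj
  have e1 : Nat.card T = F.card * ∏ i : Fin d, (Fintype.card K ^ d - Fintype.card K ^ i.1) := by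
    rw [Nat.card_sigma]
    rw [Finset.sum_congr rfl (g := fun _ => ∏ i : Fin d, (Fintype.card K ^ d - Fintype.card K ^ i.1))]
    · simp
    · intro A _
      rw [card_linearIndependent (K := K) (V := A.1) (by rw [hF _ A.2]), hF _ A.2]
  rw [e1, card_linearIndependent hd] at hc
  have hq : 1 < Fintype.card K := Fintype.one_lt_card
  have hg := aux_gbinom (Fintype.card K) (finrank K V) d
  have conv : ∀ n, d ≤ n → ((∏ i : Fin d, (Fintype.card K ^ n - Fintype.card K ^ i.1) : ℕ) : ℤ)
      = ∏ i ∈ Finset.range d, ((Fintype.card K : ℤ) ^ n - (Fintype.card K : ℤ) ^ i) := by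
    intro n hn
    rw [Finset.prod_range, Nat.cast_prod]
    apply Finset.prod_congr rfl
    intro i _
    rw [Nat.cast_sub (Nat.pow_le_pow_right (by omega) (by omega))]
    push_cast; rfl
  rw [← conv d le_rfl, ← conv _ hd] at hg
  have hg' : gbinom (Fintype.card K) (finrank K V) d * ∏ i : Fin d, (Fintype.card K ^ d - Fintype.card K ^ i.1) = ∏ i : Fin d, (Fintype.card K ^ (finrank K V) - Fintype.card K ^ i.1) := by
    exact_mod_cast hg
  rw [← hg'] at hc
  refine Nat.le_of_mul_le_mul_right hc ?_
  apply Finset.prod_pos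
  intro i _
  exact Nat.sub_pos_of_lt (Nat.pow_lt_pow_right hq i.2)

theorem stmt_16 (q n s : ℕ) (K : Type*) [Field K] [Fintype K] (hK : Fintype.card K = q)
    (V : Type*) [AddCommGroup V] [Module K V] [FiniteDimensional K V]
    (hV : finrank K V = n) (hs2 : 2 ≤ s) (hsn : s < n)
    (F : Set (Submodule K V))
    (hF : ∀ A ∈ F, ∀ B ∈ F, finrank K ↥(A ⊔ B) ≤ s)
    (hanti : ∀ A ∈ F, ∀ B ∈ F, A ≠ B → ¬ A ≤ B) :
    F.ncard ≤ gbinom q n (s / 2) := by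
  classical
  have : Finite V := Module.finite_of_finite K
  have hfin : F.Finite := Set.toFinite F
  rw [Set.ncard_eq_toFinset_card F hfin]
  obtain ⟨F1, a1, a2, a3, -⟩ := aux_push s (s / 2) (by omega) s hfin.toFinset
    (by simpa using hF)
    (by
      intro A hA B hB h
      by_contra hne
      exact hanti A (by simpa using hA) B (by simpa using hB) hne h)
    (by
      intro A hA
      have hA' : A ∈ F := by simpa using hA
      have := hF A hA' A hA'
      rw [sup_idem] at this
      omega)
  have hann : ∀ A : Submodule K V, finrank K A + finrank K A.dualAnnihilator = n := by
    intro A; rw [← hV]; exact Subspace.finrank_add_finrank_dualAnnihilator_eq A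
  have hinj : Function.Injective (fun A : Submodule K V => A.dualAnnihilator) := by
    intro A B h
    exact Subspace.dualAnnihilator_inj.mp h
  obtain ⟨F2, b1, b2, b3, b4⟩ := aux_push (K := K) (V := Dual K V) n (n - s / 2) (by omega) n
    (F1.image (fun A => A.dualAnnihilator))
    (by
      intro A _ B _
      rw [← hV, ← Subspace.dual_finrank_eq (K := K) (V := V)]
      exact Submodule.finrank_le _)
    (by
      intro A hA B hB h
      obtain ⟨A', hA', rfl⟩ := Finset.mem_image.mp hA
      obtain ⟨B', hB', rfl⟩ := Finset.mem_image.mp hB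
      rw [a1 B' hB' A' hA' (Subspace.dualAnnihilator_le_dualAnnihilator_iff.mp h)])
    (by
      intro A _
      have := Submodule.finrank_le A
      rw [Subspace.dual_finrank_eq, hV] at this
      omega)
  have b5 := b4 (by
      intro A hA
      obtain ⟨A', hA', rfl⟩ := Finset.mem_image.mp hA
      have := hann A'
      have := a2 A' hA'
      change _ ≤ finrank K A'.dualAnnihilator
      omega)
  rw [Finset.card_image_of_injective _ hinj] at b3
  have hco : ∀ W : Submodule K (Dual K V), W.dualCoannihilator.dualAnnihilator = W := fun W =>
    Subspace.dualCoannihilator_dualAnnihilator_eq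
  have hinj2 : Function.Injective (fun W : Submodule K (Dual K V) => W.dualCoannihilator) := by
    intro A B h
    have h' : A.dualCoannihilator = B.dualCoannihilator := h
    rw [← hco A, ← hco B, h']
  have hfinal := aux_count (K := K) (V := V) (s / 2) (by omega)
    (F2.image (fun W => W.dualCoannihilator)) (by
      intro A hA
      obtain ⟨W, hW, rfl⟩ := Finset.mem_image.mp hA
      have e := hann W.dualCoannihilator
      rw [hco W] at e
      have := b2 W hW
      have := b5 W hW
      change finrank K W.dualCoannihilator = _
      omega)
  rw [Finset.card_image_of_injective _ hinj2, hK, hV] at hfinal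
  omega
end
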